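/- Assume N = 2 and p = 6. Then there exists η₁ > 0 such that: for every c with 0 < c < η₁ there exist λ > -λ₁ and a positive radial solution u of (NLS_λ) with m(u) = c; and for every c > η₁ there is no λ > -λ₁ for which (NLS_λ) admits a positive radial solution u with m(u) = c. -/

import Mathlib

open Set MeasureTheory Filter Topology

noncomputable section

/-- `u` is a positive radial solution of (NLS_lam) on the annulus
`T = {x ∈ ℝ^N : 1 < |x| < 2}`: `u ∈ C²([1,2])`, `u > 0` on `(1,2)`,
`u(1) = u(2) = 0`, and `-(u'' + ((N-1)/r) u') + lam u = u^(p-1)` on `(1,2)`. -/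
def IsPosRadSol (N : ℕ) (p lam : ℝ) (u : ℝ → ℝ) : Prop :=
  ContDiffOn ℝ 2 u (Icc 1 2) ∧
  (∀ r ∈ Ioo (1:ℝ) 2, 0 < u r) ∧
  u 1 = 0 ∧ u 2 = 0 ∧
  ∀ r ∈ Ioo (1:ℝ) 2,
    -(deriv (deriv u) r + (((N : ℝ) - 1) / r) * deriv u r) + lam * u r = u r ^ (p - 1)

/-- The radial mass `m(u) = ∫₁² u(r)² r^(N-1) dr`. -/
def mass (N : ℕ) (u : ℝ → ℝ) : ℝ := ∫ r in (1:ℝ)..2, (u r) ^ 2 * r ^ (N - 1)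

/-- The first radial Dirichlet eigenvalue of `-Δ` on the annulus. -/
def lambda1 (N : ℕ) : ℝ :=
  sInf { q : ℝ | ∃ φ : ℝ → ℝ, ContDiffOn ℝ 1 φ (Icc 1 2) ∧ φ 1 = 0 ∧ φ 2 = 0 ∧
    (∃ r ∈ Icc (1:ℝ) 2, φ r ≠ 0) ∧
    q = (∫ r in (1:ℝ)..2, (deriv φ r) ^ 2 * r ^ (N - 1)) /
        (∫ r in (1:ℝ)..2, (φ r) ^ 2 * r ^ (N - 1)) }

/-! ### Monotonicity helpers -/

theorem mono_aux {f f' : ℝ → ℝ} {a b : ℝ} (hc : ContinuousOn f (Icc a b))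
    (hd : ∀ r ∈ Ioo a b, HasDerivAt f (f' r) r) (hn : ∀ r ∈ Ioo a b, 0 ≤ f' r) :
    MonotoneOn f (Icc a b) := by
  apply monotoneOn_of_hasDerivWithinAt_nonneg (f' := f') (convex_Icc a b) hc
  · intro x hx
    rw [interior_Icc] at hx ⊢
    exact (hd x hx).hasDerivWithinAt
  · intro x hx
    rw [interior_Icc] at hx
    exact hn x hx

theorem anti_aux {f f' : ℝ → ℝ} {a b : ℝ} (hc : ContinuousOn f (Icc a b))
    (hd : ∀ r ∈ Ioo a b, HasDerivAt f (f' r) r) (hn : ∀ r ∈ Ioo a b, f' r ≤ 0) :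
    AntitoneOn f (Icc a b) := by
  have := mono_aux (f := fun r => -f r) (f' := fun r => -f' r) hc.neg
    (fun r hr => (hd r hr).neg) (fun r hr => by have := hn r hr; linarith)
  intro x hx y hy hxy
  have := this hx hy hxy
  simp only at this
  linarith

theorem smono_aux {f f' : ℝ → ℝ} {a b : ℝ} (hc : ContinuousOn f (Icc a b))
    (hd : ∀ r ∈ Ioo a b, HasDerivAt f (f' r) r) (hn : ∀ r ∈ Ioo a b, 0 < f' r) :
    StrictMonoOn f (Icc a b) := by
  apply strictMonoOn_of_deriv_pos (convex_Icc a b) hc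
  intro x hx
  rw [interior_Icc] at hx
  rw [(hd x hx).deriv]
  exact hn x hx

theorem santi_aux {f f' : ℝ → ℝ} {a b : ℝ} (hc : ContinuousOn f (Icc a b))
    (hd : ∀ r ∈ Ioo a b, HasDerivAt f (f' r) r) (hn : ∀ r ∈ Ioo a b, f' r < 0) :
    StrictAntiOn f (Icc a b) := by
  have := smono_aux (f := fun r => -f r) (f' := fun r => -f' r) hc.neg
    (fun r hr => (hd r hr).neg) (fun r hr => by have := hn r hr; linarith)
  intro x hx y hy hxy
  have := this hx hy hxy
  simp only at this
  linarith

/-- The radial ODE system `y' = z / r`, `z' = r (l y - b y^5)`, with `y 1 = 0`. -/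
structure RS (l b : ℝ) (y z : ℝ → ℝ) : Prop where
  cy : ContinuousOn y (Icc 1 2)
  cz : ContinuousOn z (Icc 1 2)
  dy : ∀ r ∈ Ioo (1:ℝ) 2, HasDerivAt y (z r / r) r
  dz : ∀ r ∈ Ioo (1:ℝ) 2, HasDerivAt z (r * (l * y r - b * y r ^ 5)) r
  y1 : y 1 = 0

theorem RS.doubleZero {l b : ℝ} {y z : ℝ → ℝ} (h : RS l b y z) {ρ : ℝ} (hρ : ρ ∈ Icc (1:ℝ) 2)
    (hy : y ρ = 0) (hz : z ρ = 0) : z 1 = 0 := by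
  obtain ⟨Y, hY⟩ := isCompact_Icc.exists_bound_of_continuousOn h.cy
  have hY0 : 0 ≤ Y := le_trans (norm_nonneg _) (hY 1 (by simp))
  set K : ℝ := 1 + 2 * (|l| + |b| * Y ^ 4) with hK
  have hsub : Icc 1 ρ ⊆ Icc (1:ℝ) 2 := Icc_subset_Icc_right hρ.2
  have hm := mono_aux (f := fun r => (y r ^ 2 + z r ^ 2) * Real.exp (K * r))
    (f' := fun r => (2 * y r * (z r / r) + 2 * z r * (r * (l * y r - b * y r ^ 5))) * Real.exp (K * r)
      + (y r ^ 2 + z r ^ 2) * (Real.exp (K * r) * K)) (a := 1) (b := ρ)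
    (by
      have := h.cy.mono hsub
      have := h.cz.mono hsub
      fun_prop)
    (by
      intro r hr
      have hr' : r ∈ Ioo (1:ℝ) 2 := ⟨hr.1, hr.2.trans_le hρ.2⟩
      have h1 := (h.dy r hr').pow 2
      have h2 := (h.dz r hr').pow 2
      have h3 : HasDerivAt (fun r => Real.exp (K * r)) (Real.exp (K * r) * K) r := by
        have := ((hasDerivAt_id r).const_mul K).exp
        simpa using this
      have := (h1.add h2).mul h3
      refine this.congr_deriv ?_
      simp)
    (by
      intro r hr
      have hr' : r ∈ Ioo (1:ℝ) 2 := ⟨hr.1, hr.2.trans_le hρ.2⟩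
      have hr1 : 1 < r := hr'.1
      have hr2 : r < 2 := hr'.2
      have hyr : |y r| ≤ Y := hY r ⟨hr1.le, hr2.le⟩
      have hA : |2 * y r * (z r / r)| ≤ y r ^ 2 + z r ^ 2 := by
        have : |2 * y r * (z r / r)| = (2 * |y r| * |z r|) / r := by
          rw [abs_mul, abs_mul, abs_div, abs_of_pos (by linarith : (0:ℝ) < r)]
          simp; ring
        rw [this, div_le_iff₀ (by linarith)]
        have h1 : 2 * |y r| * |z r| ≤ y r ^ 2 + z r ^ 2 := by
          nlinarith [sq_nonneg (|y r| - |z r|), sq_abs (y r), sq_abs (z r)]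
        nlinarith [sq_nonneg (y r), sq_nonneg (z r)]
      have hB : |2 * z r * (r * (l * y r - b * y r ^ 5))| ≤
          2 * (|l| + |b| * Y ^ 4) * (y r ^ 2 + z r ^ 2) := by
        have h0 : |2 * z r * (r * (l * y r - b * y r ^ 5))| =
          r * (2 * |y r| * |z r|) * |l - b * y r ^ 4| := by
          have : 2 * z r * (r * (l * y r - b * y r ^ 5)) =
            r * (2 * y r * z r) * (l - b * y r ^ 4) := by ring
          rw [this, abs_mul, abs_mul, abs_mul, abs_mul, abs_of_pos (by linarith : (0:ℝ) < r)]
          simp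
        have h1 : 2 * |y r| * |z r| ≤ y r ^ 2 + z r ^ 2 := by
          nlinarith [sq_nonneg (|y r| - |z r|), sq_abs (y r), sq_abs (z r)]
        have h2 : |l - b * y r ^ 4| ≤ |l| + |b| * Y ^ 4 := by
          calc |l - b * y r ^ 4| ≤ |l| + |b * y r ^ 4| := abs_sub _ _
            _ = |l| + |b| * |y r| ^ 4 := by rw [abs_mul, abs_pow]
            _ ≤ _ := by gcongr
        rw [h0]
        calc r * (2 * |y r| * |z r|) * |l - b * y r ^ 4|
            ≤ 2 * (y r ^ 2 + z r ^ 2) * (|l| + |b| * Y ^ 4) := by gcongr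
          _ = _ := by ring
      have := Real.exp_pos (K * r)
      have h5 : 0 ≤ (2 * y r * (z r / r) + 2 * z r * (r * (l * y r - b * y r ^ 5)))
        + (y r ^ 2 + z r ^ 2) * K := by
        have e1 := (abs_le.1 hA).1
        have e2 := (abs_le.1 hB).1
        rw [hK]; linarith
      have := mul_nonneg h5 this.le
      linarith)
  have := hm ⟨le_rfl, hρ.1⟩ ⟨hρ.1, le_rfl⟩ hρ.1
  simp only [hy, hz, h.y1] at this
  have he := Real.exp_pos (K * 1)
  have h7 : z 1 ^ 2 * Real.exp (K * 1) ≤ 0 := by simpa using this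
  have h8 : z 1 ^ 2 ≤ 0 := by
    by_contra hc
    push Not at hc
    have := mul_pos hc he
    linarith
  exact pow_eq_zero_iff (two_ne_zero) |>.1 (le_antisymm h8 (sq_nonneg _))

theorem RS.pos_of_nonneg {l b : ℝ} {y z : ℝ → ℝ} (h : RS l b y z) (hz : z 1 ≠ 0)
    (hy : ∀ r ∈ Icc (1:ℝ) 2, 0 ≤ y r) : ∀ r ∈ Ioo (1:ℝ) 2, 0 < y r := by
  intro r hr
  by_contra hc
  have h0 : y r = 0 := le_antisymm (not_lt.1 hc) (hy r ⟨hr.1.le, hr.2.le⟩)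
  have hmin : IsLocalMin y r := by
    filter_upwards [Icc_mem_nhds hr.1 hr.2] with x hx
    rw [h0]; exact hy x hx
  have := hmin.hasDerivAt_eq_zero (h.dy r hr)
  have hr0 : r ≠ 0 := by have := hr.1; linarith
  have hz0 : z r = 0 := by
    rcases div_eq_zero_iff.1 this with h | h
    · exact h
    · exact absurd h hr0
  exact hz (h.doubleZero ⟨hr.1.le, hr.2.le⟩ h0 hz0)

theorem RS.deriv_one {l b : ℝ} {y z : ℝ → ℝ} (h : RS l b y z) :
    HasDerivWithinAt y (z 1) (Ici 1) 1 := by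
  apply hasDerivWithinAt_Ici_of_tendsto_deriv (s := Ioo 1 2)
  · intro r hr
    exact (h.dy r hr).differentiableAt.differentiableWithinAt
  · exact (h.cy 1 (by simp)).mono Ioo_subset_Icc_self
  · exact Ioo_mem_nhdsGT (by norm_num)
  · have h1 : Tendsto (fun r => z r / r) (𝓝[>] 1) (𝓝 (z 1)) := by
      have h2 : Tendsto z (𝓝[>] 1) (𝓝 (z 1)) := by
        have := (h.cz 1 (by simp))
        exact this.mono_of_mem_nhdsWithin (Icc_mem_nhdsGT (by norm_num))
      have h3 : Tendsto (fun r : ℝ => r) (𝓝[>] 1) (𝓝 1) := tendsto_id.mono_left nhdsWithin_le_nhds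
      have := h2.div h3 one_ne_zero
      rw [div_one] at this
      exact this
    apply h1.congr'
    filter_upwards [Ioo_mem_nhdsGT (show (1:ℝ) < 2 by norm_num)] with r hr
    exact (h.dy r hr).deriv.symm

theorem RS.deriv_two {l b : ℝ} {y z : ℝ → ℝ} (h : RS l b y z) :
    HasDerivWithinAt y (z 2 / 2) (Iic 2) 2 := by
  apply hasDerivWithinAt_Iic_of_tendsto_deriv (s := Ioo 1 2)
  · intro r hr
    exact (h.dy r hr).differentiableAt.differentiableWithinAt
  · exact (h.cy 2 (by simp)).mono Ioo_subset_Icc_self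
  · exact Ioo_mem_nhdsLT (by norm_num)
  · have h1 : Tendsto (fun r => z r / r) (𝓝[<] 2) (𝓝 (z 2 / 2)) := by
      have h2 : Tendsto z (𝓝[<] 2) (𝓝 (z 2)) := by
        have := (h.cz 2 (by simp))
        exact this.mono_of_mem_nhdsWithin (Icc_mem_nhdsLT (by norm_num))
      have h3 : Tendsto (fun r : ℝ => r) (𝓝[<] 2) (𝓝 2) := tendsto_id.mono_left nhdsWithin_le_nhds
      exact h2.div h3 two_ne_zero
    apply h1.congr'
    filter_upwards [Ioo_mem_nhdsLT (show (1:ℝ) < 2 by norm_num)] with r hr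
    exact (h.dy r hr).deriv.symm

/-- the quotient `y / (r-1)` at the left end point. -/
theorem RS.slope_one {l b : ℝ} {y z : ℝ → ℝ} (h : RS l b y z) :
    Tendsto (fun r => y r / (r - 1)) (𝓝[>] 1) (𝓝 (z 1)) := by
  have := (hasDerivWithinAt_iff_tendsto_slope.1 h.deriv_one)
  have h2 : Ici (1:ℝ) \ {1} = Ioi 1 := by ext x; simp [lt_iff_le_and_ne, eq_comm]
  rw [h2] at this
  apply this.congr
  intro r
  rw [slope_def_field, h.y1]; simp

theorem RS.slope_two {l b : ℝ} {y z : ℝ → ℝ} (h : RS l b y z) (hy : y 2 = 0) :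
    Tendsto (fun r => y r / (r - 2)) (𝓝[<] 2) (𝓝 (z 2 / 2)) := by
  have := (hasDerivWithinAt_iff_tendsto_slope.1 h.deriv_two)
  have h2 : Iic (2:ℝ) \ {2} = Iio 2 := by ext x; simp [lt_iff_le_and_ne]
  rw [h2] at this
  apply this.congr
  intro r
  rw [slope_def_field, hy]; simp

theorem RS.pos_near_one {l b : ℝ} {y z : ℝ → ℝ} (h : RS l b y z) (hz : 0 < z 1) :
    ∃ δ > 0, δ < 1 ∧ ∀ r ∈ Ioc 1 (1 + δ), 0 < y r := by
  have h1 : ∀ᶠ r in 𝓝[>] (1:ℝ), 0 < y r := by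
    filter_upwards [h.slope_one.eventually (lt_mem_nhds hz), self_mem_nhdsWithin] with r hr h1
    have h1' : (0:ℝ) < r - 1 := by simpa using h1
    have := mul_pos hr h1'
    rwa [div_mul_cancel₀ _ h1'.ne'] at this
  obtain ⟨u, hu, hs⟩ := mem_nhdsGT_iff_exists_Ioo_subset.1 h1
  have hu : 1 < u := hu
  refine ⟨min ((u-1)/2) (1/2), lt_min (by linarith) (by norm_num), ?_, ?_⟩
  · exact lt_of_le_of_lt (min_le_right _ _) (by norm_num)
  · intro r hr
    refine hs ⟨hr.1, ?_⟩
    have := hr.2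
    have := min_le_left ((u-1)/2) (1/2)
    linarith

theorem RS.z_nonpos {l b : ℝ} {y z : ℝ → ℝ} (h : RS l b y z) {ρ : ℝ} (hρ : ρ ∈ Ioc (1:ℝ) 2)
    (hpos : ∀ r ∈ Ioo 1 ρ, 0 < y r) (hy : y ρ = 0) : z ρ ≤ 0 := by
  by_contra hc
  push Not at hc
  have hcw : ContinuousWithinAt z (Icc 1 2) ρ := h.cz ρ ⟨hρ.1.le, hρ.2⟩
  have : ∀ᶠ r in 𝓝[<] ρ, 0 < z r := by
    have h2 : Tendsto z (𝓝[<] ρ) (𝓝 (z ρ)) :=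
      hcw.mono_of_mem_nhdsWithin (by
        filter_upwards [Ioo_mem_nhdsLT hρ.1] with x hx
        exact ⟨hx.1.le, hx.2.le.trans hρ.2⟩)
    exact h2.eventually (lt_mem_nhds hc)
  obtain ⟨u, hu, hs⟩ := mem_nhdsLT_iff_exists_Ioo_subset.1 this
  have hu : u < ρ := hu
  set a := max ((u+ρ)/2) ((1+ρ)/2)
  have ha1 : a < ρ := max_lt (by linarith) (by linarith [hρ.1])
  have ha2 : u < a := lt_of_lt_of_le (by linarith) (le_max_left _ _)
  have ha3 : 1 < a := lt_of_lt_of_le (by linarith [hρ.1]) (le_max_right _ _)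
  have hm := smono_aux (f := y) (f' := fun r => z r / r) (a := a) (b := ρ)
    (h.cy.mono (Icc_subset_Icc ha3.le hρ.2))
    (fun r hr => h.dy r ⟨ha3.trans hr.1, hr.2.trans_le hρ.2⟩)
    (fun r hr => div_pos (hs ⟨ha2.trans hr.1, hr.2⟩) (by linarith [hr.1]))
  have := hm ⟨le_rfl, ha1.le⟩ ⟨ha1.le, le_rfl⟩ ha1
  have := hpos a ⟨ha3, ha1⟩
  linarith

theorem RS.firstZero {l b : ℝ} {y z : ℝ → ℝ} (h : RS l b y z) (hz : 0 < z 1)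
    (hn : ¬ ∀ r ∈ Ioc (1:ℝ) 2, 0 < y r) :
    ∃ ρ ∈ Ioc (1:ℝ) 2, (∀ r ∈ Ioo 1 ρ, 0 < y r) ∧ y ρ = 0 := by
  obtain ⟨δ, hδ, hδ1, hp⟩ := h.pos_near_one hz
  push Not at hn
  obtain ⟨s, hs, hys⟩ := hn
  have hsδ : 1 + δ < s := by
    by_contra hc
    push Not at hc
    have := hp s ⟨hs.1, hc⟩
    linarith
  have hcc : IsCompact {r ∈ Icc (1+δ) 2 | y r ≤ 0} := by
    have hcl : IsClosed {r ∈ Icc (1+δ) 2 | y r ≤ 0} := by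
      have := (h.cy.mono (Icc_subset_Icc_left (by linarith : 1 ≤ 1 + δ))).preimage_isClosed_of_isClosed
        isClosed_Icc (isClosed_Iic (a := (0:ℝ)))
      exact this
    exact isCompact_Icc.of_isClosed_subset hcl (fun x hx => hx.1)
  obtain ⟨ρ, hρ, hmin⟩ := hcc.exists_isLeast ⟨s, ⟨hsδ.le, hs.2⟩, hys⟩
  have hρ1 : 1 < ρ := by have := hρ.1.1; linarith
  have hpos : ∀ r ∈ Ioo 1 ρ, 0 < y r := by
    intro r hr
    by_contra hc
    push Not at hc
    rcases le_total r (1+δ) with h1 | h1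
    · have := hp r ⟨hr.1, h1⟩; linarith
    · have := hmin ⟨⟨h1, hr.2.le.trans hρ.1.2⟩, hc⟩
      have := hr.2
      linarith
  refine ⟨ρ, ⟨hρ1, hρ.1.2⟩, hpos, le_antisymm hρ.2 ?_⟩
  have h2 : Tendsto y (𝓝[<] ρ) (𝓝 (y ρ)) :=
    (h.cy ρ ⟨hρ1.le, hρ.1.2⟩).mono_of_mem_nhdsWithin (by
      filter_upwards [Ioo_mem_nhdsLT hρ1] with x hx
      exact ⟨hx.1.le, hx.2.le.trans hρ.1.2⟩)
  apply ge_of_tendsto h2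
  filter_upwards [Ioo_mem_nhdsLT hρ1] with x hx
  exact (hpos x hx).le

theorem lim_lt_aux {f f' : ℝ → ℝ} {a b c : ℝ} (hab : a < b) (hc : ContinuousOn f (Ioc a b))
    (hd : ∀ r ∈ Ioo a b, HasDerivAt f (f' r) r) (hn : ∀ r ∈ Ioo a b, 0 < f' r)
    (hl : Tendsto f (𝓝[>] a) (𝓝 c)) : c < f b := by
  set m := (a + b) / 2 with hm
  have h1 : a < m := by rw [hm]; linarith
  have h2 : m < b := by rw [hm]; linarith
  have key : ∀ x, a < x → x < b → f x < f b := by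
    intro x hx hxb
    refine smono_aux (f := f) (f' := f') (a := x) (b := b)
      (hc.mono (fun t ht => ⟨hx.trans_le ht.1, ht.2⟩))
      (fun r hr => hd r ⟨hx.trans hr.1, hr.2⟩) (fun r hr => hn r ⟨hx.trans hr.1, hr.2⟩)
      ⟨le_rfl, hxb.le⟩ ⟨hxb.le, le_rfl⟩ hxb
  have key2 : ∀ x, a < x → x < m → f x < f m := by
    intro x hx hxb
    refine smono_aux (f := f) (f' := f') (a := x) (b := m)
      (hc.mono (fun t ht => ⟨hx.trans_le ht.1, ht.2.trans h2.le⟩))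
      (fun r hr => hd r ⟨hx.trans hr.1, hr.2.trans h2⟩)
      (fun r hr => hn r ⟨hx.trans hr.1, hr.2.trans h2⟩)
      ⟨le_rfl, hxb.le⟩ ⟨hxb.le, le_rfl⟩ hxb
  have h3 : c ≤ f m := by
    apply le_of_tendsto hl
    filter_upwards [Ioo_mem_nhdsGT h1] with x hx
    exact (key2 x hx.1 hx.2).le
  exact h3.trans_lt (key m h1 h2)

theorem lt_lim_aux {f f' : ℝ → ℝ} {a b c : ℝ} (hab : a < b) (hc : ContinuousOn f (Ico a b))
    (hd : ∀ r ∈ Ioo a b, HasDerivAt f (f' r) r) (hn : ∀ r ∈ Ioo a b, 0 < f' r)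
    (hl : Tendsto f (𝓝[<] b) (𝓝 c)) : f a < c := by
  set m := (a + b) / 2 with hm
  have h1 : a < m := by rw [hm]; linarith
  have h2 : m < b := by rw [hm]; linarith
  have key : ∀ x y, a ≤ x → x < y → y < b → f x < f y := by
    intro x y hx hxy hyb
    refine smono_aux (f := f) (f' := f') (a := x) (b := y)
      (hc.mono (fun t ht => ⟨hx.trans ht.1, ht.2.trans_lt hyb⟩))
      (fun r hr => hd r ⟨hx.trans_lt hr.1, hr.2.trans hyb⟩)
      (fun r hr => hn r ⟨hx.trans_lt hr.1, hr.2.trans hyb⟩)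
      ⟨le_rfl, hxy.le⟩ ⟨hxy.le, le_rfl⟩ hxy
  have h3 : f m ≤ c := by
    apply ge_of_tendsto hl
    filter_upwards [Ioo_mem_nhdsLT h2] with x hx
    exact (key m x h1.le hx.1 hx.2).le
  exact (key a m le_rfl h1 h2).trans_le h3

/-- Generalized Pohozaev function. -/
def PJ (l b : ℝ) (y z : ℝ → ℝ) (r : ℝ) : ℝ :=
  (z r ^ 2 / 2 + y r * z r / 4 + y r ^ 2 / 16 + r ^ 2 * (b * y r ^ 6 / 6 - l * y r ^ 2 / 2))
    * (Real.sqrt r)⁻¹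

def Pg (l r : ℝ) : ℝ := (r * l / 2 + 1 / (32 * r)) * (Real.sqrt r)⁻¹

theorem RS.cPJ {l b : ℝ} {y z : ℝ → ℝ} (h : RS l b y z) : ContinuousOn (PJ l b y z) (Icc 1 2) := by
  have h1 := h.cy
  have h2 := h.cz
  have h3 : ContinuousOn (fun r : ℝ => (Real.sqrt r)⁻¹) (Icc 1 2) := by
    apply ContinuousOn.inv₀ (Real.continuous_sqrt.continuousOn)
    intro r hr
    have : (0:ℝ) < r := by have := hr.1; linarith
    exact (Real.sqrt_pos.2 this).ne'
  unfold PJ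
  fun_prop

theorem RS.dPJ {l b : ℝ} {y z : ℝ → ℝ} (h : RS l b y z) {r : ℝ} (hr : r ∈ Ioo (1:ℝ) 2) :
    HasDerivAt (PJ l b y z) (-(Pg l r * y r ^ 2)) r := by
  have hr0 : (0:ℝ) < r := by have := hr.1; linarith
  have hs : 0 < Real.sqrt r := Real.sqrt_pos.2 hr0
  have hss : Real.sqrt r ^ 2 = r := Real.sq_sqrt hr0.le
  have h1 := h.dy r hr
  have h2 := h.dz r hr
  have h3 : HasDerivAt (fun r : ℝ => (Real.sqrt r)⁻¹) (-(1 / (2 * Real.sqrt r)) / Real.sqrt r ^ 2) r :=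
    (Real.hasDerivAt_sqrt hr0.ne').inv hs.ne'
  have h4 := ((((h2.pow 2).div_const 2).add ((h1.mul h2).div_const 4)).add
    ((h1.pow 2).div_const 16)).add
    ((hasDerivAt_pow 2 r).mul ((((h1.pow 6).const_mul b).div_const 6).sub
      (((h1.pow 2).const_mul l).div_const 2)))
  have h5 := h4.mul h3
  refine (h5.congr_deriv ?_)
  simp only [Pi.add_apply, Pi.mul_apply, Pi.pow_apply, Pi.sub_apply, Pg]
  rw [hss]
  field_simp
  ring

theorem RS.PJ_pos {l b : ℝ} {y z : ℝ → ℝ} (h : RS l b y z) (hb : 0 ≤ b)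
    (hy : ∀ r ∈ Ioo (1:ℝ) 2, 0 < y r) (h2 : y 2 = 0) :
    ∀ r ∈ Ioo (1:ℝ) 2, 0 < PJ l b y z r := by
  intro r hr
  have hr0 : (0:ℝ) < r := by have := hr.1; linarith
  rcases le_total l 0 with hl | hl
  · unfold PJ
    have hs : 0 < Real.sqrt r := Real.sqrt_pos.2 hr0
    have hyr := hy r hr
    refine mul_pos ?_ (inv_pos.2 hs)
    have e1 : 0 ≤ b * y r ^ 6 / 6 := by positivity
    have e2 : 0 ≤ -l * y r ^ 2 / 2 := by
      have : 0 ≤ -l := by linarith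
      positivity
    have e3 : 0 ≤ r ^ 2 * (b * y r ^ 6 / 6 - l * y r ^ 2 / 2) :=
      mul_nonneg (sq_nonneg _) (by linarith)
    nlinarith [sq_nonneg (z r + y r / 4), sq_nonneg (y r), mul_pos hyr hyr]
  · have hm := santi_aux (f := PJ l b y z) (f' := fun r => -(Pg l r * y r ^ 2)) (a := r) (b := 2)
      (h.cPJ.mono (Icc_subset_Icc_left hr.1.le))
      (fun s hs => h.dPJ ⟨hr.1.trans hs.1, hs.2⟩)
      (fun s hs => by
        have hs0 : 0 < s := hr0.trans hs.1
        have h3 : 0 < Real.sqrt s := Real.sqrt_pos.2 hs0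
        have h4 := hy s ⟨hr.1.trans hs.1, hs.2⟩
        have : 0 < Pg l s * y s ^ 2 := by unfold Pg; positivity
        linarith)
    have := hm ⟨le_rfl, hr.2.le⟩ ⟨hr.2.le, le_rfl⟩ hr.2
    refine lt_of_le_of_lt ?_ this
    unfold PJ
    rw [h2]
    have : (0:ℝ) ≤ z 2 ^ 2 := sq_nonneg _
    simp
    positivity

/-- The Wronskian. -/
theorem RS.wronskian {l m b c : ℝ} {y z Y Z : ℝ → ℝ} (h : RS l b y z) (H : RS m c Y Z) {r : ℝ}
    (hr : r ∈ Ioo (1:ℝ) 2) :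
    HasDerivAt (fun r => Z r * y r - Y r * z r)
      (r * y r * Y r * ((m - l) + (b * y r ^ 4 - c * Y r ^ 4))) r := by
  have hr0 : r ≠ 0 := by have := hr.1; linarith
  have := ((H.dz r hr).mul (h.dy r hr)).sub ((H.dy r hr).mul (h.dz r hr))
  refine this.congr_deriv ?_
  field_simp
  ring

theorem RS.cwronskian {l m b c : ℝ} {y z Y Z : ℝ → ℝ} (h : RS l b y z) (H : RS m c Y Z) :
    ContinuousOn (fun r => Z r * y r - Y r * z r) (Icc 1 2) :=
  (H.cz.mul h.cy).sub (H.cy.mul h.cz)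

theorem RS.unique_aux {l b c : ℝ} {y z Y Z : ℝ → ℝ} (h : RS l b y z) (H : RS l c Y Z)
    (hb : 0 ≤ b) (hbc : b < c) (hz : z 1 = 1) (hZ : Z 1 = 1)
    (hy : ∀ r ∈ Ioo (1:ℝ) 2, 0 < y r) (hY : ∀ r ∈ Ioo (1:ℝ) 2, 0 < Y r)
    (hy2 : y 2 = 0) (hY2 : Y 2 = 0) : False := by
  have hJ := h.PJ_pos hb hy hy2
  have hz2 : z 2 ≠ 0 := by
    intro h0
    have := h.doubleZero (ρ := 2) (by simp) hy2 h0
    rw [hz] at this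
    norm_num at this
  set W : ℝ → ℝ := fun r => Z r * y r - Y r * z r with hW
  set w : ℝ → ℝ := fun r => Y r / y r with hw
  set X : ℝ → ℝ := fun r => PJ l c Y Z r - w r ^ 2 * PJ l b y z r with hX
  have hwpos : ∀ r ∈ Ioo (1:ℝ) 2, 0 < w r := fun r hr => div_pos (hY r hr) (hy r hr)
  have dw : ∀ r ∈ Ioo (1:ℝ) 2, HasDerivAt w (W r / (r * y r ^ 2)) r := by
    intro r hr
    have hr0 : r ≠ 0 := by have := hr.1; linarith
    have hy0 := (hy r hr).ne'
    have := (H.dy r hr).div (h.dy r hr) hy0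
    refine this.congr_deriv ?_
    simp only [hW]
    field_simp
  have dX : ∀ r ∈ Ioo (1:ℝ) 2, HasDerivAt X (-(2 * w r * (W r / (r * y r ^ 2)) * PJ l b y z r)) r := by
    intro r hr
    have hy0 := (hy r hr).ne'
    have := (H.dPJ hr).sub (((dw r hr).pow 2).mul (h.dPJ hr))
    refine this.congr_deriv ?_
    have : Y r = w r * y r := by simp only [hw]; field_simp
    rw [this]
    simp only [Pi.pow_apply]
    ring
  have dW : ∀ r ∈ Ioo (1:ℝ) 2, HasDerivAt W (r * y r * Y r * (b * y r ^ 4 - c * Y r ^ 4)) r := by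
    intro r hr
    have := h.wronskian H hr
    refine this.congr_deriv ?_
    ring
  have cW : ContinuousOn W (Icc 1 2) := h.cwronskian H
  have W1 : W 1 = 0 := by simp only [hW, h.y1, H.y1]; ring
  have limw1 : Tendsto w (𝓝[>] 1) (𝓝 1) := by
    have := H.slope_one.div h.slope_one (by rw [hz]; norm_num)
    rw [hz, hZ, div_one] at this
    apply this.congr'
    filter_upwards [self_mem_nhdsWithin] with r hr
    have : r - 1 ≠ 0 := by have : 1 < r := hr; linarith
    simp only [hw, Pi.div_apply]
    rw [div_div_div_cancel_right₀ this]
  have limw2 : Tendsto w (𝓝[<] 2) (𝓝 (Z 2 / z 2)) := by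
    have := (H.slope_two hY2).div (h.slope_two hy2) (by
      intro h0; apply hz2; linarith)
    rw [div_div_div_cancel_right₀ two_ne_zero] at this
    apply this.congr'
    filter_upwards [self_mem_nhdsWithin] with r hr
    have : r - 2 ≠ 0 := by have : r < 2 := hr; linarith
    simp only [hw, Pi.div_apply]
    rw [div_div_div_cancel_right₀ this]
  have limX1 : Tendsto X (𝓝[>] 1) (𝓝 0) := by
    have e1 : Tendsto (PJ l c Y Z) (𝓝[>] 1) (𝓝 (PJ l c Y Z 1)) :=
      (H.cPJ 1 (by simp)).mono_of_mem_nhdsWithin (Icc_mem_nhdsGT (by norm_num))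
    have e2 : Tendsto (PJ l b y z) (𝓝[>] 1) (𝓝 (PJ l b y z 1)) :=
      (h.cPJ 1 (by simp)).mono_of_mem_nhdsWithin (Icc_mem_nhdsGT (by norm_num))
    have := e1.sub ((limw1.pow 2).mul e2)
    convert this using 2
    simp [PJ, h.y1, H.y1, hz, hZ]
  have limX2 : Tendsto X (𝓝[<] 2) (𝓝 0) := by
    have e1 : Tendsto (PJ l c Y Z) (𝓝[<] 2) (𝓝 (PJ l c Y Z 2)) :=
      (H.cPJ 2 (by simp)).mono_of_mem_nhdsWithin (Icc_mem_nhdsLT (by norm_num))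
    have e2 : Tendsto (PJ l b y z) (𝓝[<] 2) (𝓝 (PJ l b y z 2)) :=
      (h.cPJ 2 (by simp)).mono_of_mem_nhdsWithin (Icc_mem_nhdsLT (by norm_num))
    have := e1.sub ((limw2.pow 2).mul e2)
    convert this using 2
    simp only [PJ, hy2, hY2]
    field_simp
    ring
  obtain ⟨δ, hδ, hδ1, hWδ⟩ : ∃ δ > 0, δ < 1 ∧ ∀ r ∈ Ioo 1 (1 + δ), W r < 0 := by
    have hev : ∀ᶠ r in 𝓝[>] (1:ℝ), b - c * w r ^ 4 < 0 := by
      have : Tendsto (fun r => b - c * w r ^ 4) (𝓝[>] 1) (𝓝 (b - c * 1 ^ 4)) :=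
        tendsto_const_nhds.sub ((limw1.pow 4).const_mul c)
      exact this.eventually (gt_mem_nhds (by linarith))
    obtain ⟨u, hu, hs⟩ := mem_nhdsGT_iff_exists_Ioo_subset.1 hev
    have hu : 1 < u := hu
    refine ⟨min (u-1) (1/2), lt_min (by linarith) (by norm_num),
      lt_of_le_of_lt (min_le_right _ _) (by norm_num), ?_⟩
    intro r hr
    have hru : r < u := by
      have := hr.2; have := min_le_left (u-1) (1/2); linarith
    have hr2 : r < 2 := by
      have := hr.2; have := min_le_right (u-1) (1/2); linarith
    have hm := santi_aux (f := W) (a := 1) (b := r) (cW.mono (Icc_subset_Icc_right hr2.le))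
      (fun s hs => dW s ⟨hs.1, hs.2.trans hr2⟩) (fun s hss => by
        have hs' : s ∈ Ioo (1:ℝ) 2 := ⟨hss.1, hss.2.trans hr2⟩
        have e1 : b - c * w s ^ 4 < 0 := hs ⟨hss.1, hss.2.trans hru⟩
        have e2 := hy s hs'
        have e3 := hY s hs'
        have e4 : 0 < s := by linarith [hss.1]
        have e5 : Y s = w s * y s := by simp only [hw]; field_simp
        have e6 : b * y s ^ 4 - c * Y s ^ 4 = y s ^ 4 * (b - c * w s ^ 4) := by rw [e5]; ring
        rw [e6]
        have : 0 < y s ^ 4 := by positivity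
        exact mul_neg_of_pos_of_neg (by positivity) (mul_neg_of_pos_of_neg this e1))
    have := hm ⟨le_rfl, hr.1.le⟩ ⟨hr.1.le, le_rfl⟩ hr.1
    rwa [W1] at this
  have Xpos_deriv : ∀ r ∈ Ioo (1:ℝ) 2, W r < 0 →
      0 < -(2 * w r * (W r / (r * y r ^ 2)) * PJ l b y z r) := by
    intro r hr hWr
    have e1 := hwpos r hr
    have e2 := hy r hr
    have e3 := hJ r hr
    have e4 : 0 < r := by linarith [hr.1]
    have e5 : 0 < -W r / (r * y r ^ 2) := div_pos (by linarith) (by positivity)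
    have : 0 < 2 * w r * (-W r / (r * y r ^ 2)) * PJ l b y z r := by positivity
    have e6 : 2 * w r * (-W r / (r * y r ^ 2)) * PJ l b y z r
      = -(2 * w r * (W r / (r * y r ^ 2)) * PJ l b y z r) := by ring
    linarith
  have cX : ContinuousOn X (Ioo 1 2) := fun r hr => (dX r hr).continuousAt.continuousWithinAt
  have hWneg : ∀ r ∈ Ioo (1:ℝ) 2, W r < 0 := by
    by_contra hcon
    push Not at hcon
    obtain ⟨s, hs, hWs⟩ := hcon
    have hsδ : 1 + δ ≤ s := by
      by_contra hc
      push Not at hc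
      have := hWδ s ⟨hs.1, hc⟩
      linarith
    have hcc : IsCompact {r ∈ Icc (1+δ) s | 0 ≤ W r} := by
      have hcl : IsClosed {r ∈ Icc (1+δ) s | 0 ≤ W r} :=
        (cW.mono (Icc_subset_Icc (by linarith : 1 ≤ 1 + δ) hs.2.le)).preimage_isClosed_of_isClosed
          isClosed_Icc (isClosed_Ici (a := (0:ℝ)))
      exact isCompact_Icc.of_isClosed_subset hcl (fun x hx => hx.1)
    obtain ⟨ρ, hρ, hmin⟩ := hcc.exists_isLeast ⟨s, ⟨hsδ, le_rfl⟩, hWs⟩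
    have hρ1 : 1 < ρ := by have := hρ.1.1; linarith
    have hρ2 : ρ < 2 := hρ.1.2.trans_lt hs.2
    have hρI : ρ ∈ Ioo (1:ℝ) 2 := ⟨hρ1, hρ2⟩
    have hneg : ∀ r ∈ Ioo 1 ρ, W r < 0 := by
      intro r hr
      by_contra hc
      push Not at hc
      rcases lt_or_ge r (1+δ) with h1 | h1
      · have := hWδ r ⟨hr.1, h1⟩; linarith
      · have := hmin ⟨⟨h1, hr.2.le.trans hρ.1.2⟩, hc⟩
        have := hr.2
        linarith
    have hWρ : W ρ = 0 := by
      refine le_antisymm ?_ hρ.2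
      have h2 : Tendsto W (𝓝[<] ρ) (𝓝 (W ρ)) := (dW ρ hρI).continuousAt.tendsto.mono_left nhdsWithin_le_nhds
      apply le_of_tendsto h2
      filter_upwards [Ioo_mem_nhdsLT hρ1] with x hx
      exact (hneg x hx).le
    have hXρ : 0 < X ρ := lim_lt_aux hρ1
      (cX.mono (fun t ht => ⟨ht.1, ht.2.trans_lt hρ2⟩))
      (fun r hr => dX r ⟨hr.1, hr.2.trans hρ2⟩)
      (fun r hr => Xpos_deriv r ⟨hr.1, hr.2.trans hρ2⟩ (hneg r hr)) limX1
    have e1 := hy ρ hρI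
    have e3 := hwpos ρ hρI
    have eY : ∀ r ∈ Ioo (1:ℝ) 2, Y r = w r * y r := by
      intro r hr
      have := (hy r hr).ne'
      simp only [hw]; field_simp
    have hr0 : 0 < ρ := by linarith
    have eZ : Z ρ = w ρ * z ρ := by
      have : Z ρ * y ρ - Y ρ * z ρ = 0 := hWρ
      rw [eY ρ hρI] at this
      have h7 : (Z ρ - w ρ * z ρ) * y ρ = 0 := by linarith
      rcases mul_eq_zero.1 h7 with h8 | h8
      · linarith
      · exact absurd h8 e1.ne'
    have hXf : X ρ = (ρ ^ 2 * (Real.sqrt ρ)⁻¹ / 6 * w ρ ^ 2 * y ρ ^ 6) * (c * w ρ ^ 4 - b) := by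
      simp only [hX, PJ]
      rw [eZ, eY ρ hρI]
      ring
    have hs' : 0 < Real.sqrt ρ := Real.sqrt_pos.2 hr0
    have hcw : 0 < c * w ρ ^ 4 - b := by
      rw [hXf] at hXρ
      exact (pos_iff_pos_of_mul_pos hXρ).1 (by positivity)
    have hwanti := santi_aux (f := W) (a := 1) (b := ρ) (cW.mono (Icc_subset_Icc_right hρ2.le))
      (fun s hs => dW s ⟨hs.1, hs.2.trans hρ2⟩) (fun s hss => by
        have hs' : s ∈ Ioo (1:ℝ) 2 := ⟨hss.1, hss.2.trans hρ2⟩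
        have hwm := santi_aux (f := w) (a := s) (b := ρ)
          (fun t ht => (dw t ⟨hss.1.trans_le ht.1, ht.2.trans_lt hρ2⟩).continuousAt.continuousWithinAt)
          (fun t ht => dw t ⟨hss.1.trans ht.1, ht.2.trans hρ2⟩)
          (fun t ht => by
            have ht1 : 1 < t := hss.1.trans ht.1
            have := hy t ⟨ht1, ht.2.trans hρ2⟩
            exact div_neg_of_neg_of_pos (hneg t ⟨ht1, ht.2⟩) (by positivity))
        have hlt : w ρ < w s := hwm ⟨le_rfl, hss.2.le⟩ ⟨hss.2.le, le_rfl⟩ hss.2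
        have h44 : w ρ ^ 4 ≤ w s ^ 4 := by gcongr
        have hc0 : 0 ≤ c := by linarith
        have e1 : b - c * w s ^ 4 < 0 := by nlinarith
        have e2 := hy s hs'
        have e3 := hY s hs'
        have e4 : 0 < s := by linarith [hss.1]
        have e6 : b * y s ^ 4 - c * Y s ^ 4 = y s ^ 4 * (b - c * w s ^ 4) := by rw [eY s hs']; ring
        rw [e6]
        have : 0 < y s ^ 4 := by positivity
        exact mul_neg_of_pos_of_neg (by positivity) (mul_neg_of_pos_of_neg this e1))
    have := hwanti ⟨le_rfl, hρ1.le⟩ ⟨hρ1.le, le_rfl⟩ hρ1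
    linarith
  have a1 : 0 < X (3/2) := lim_lt_aux (by norm_num)
      (cX.mono (fun t ht => ⟨ht.1, ht.2.trans_lt (by norm_num)⟩))
      (fun r hr => dX r ⟨hr.1, hr.2.trans (by norm_num)⟩)
      (fun r hr => Xpos_deriv r ⟨hr.1, hr.2.trans (by norm_num)⟩ (hWneg r ⟨hr.1, hr.2.trans (by norm_num)⟩)) limX1
  have a2 : X (3/2) < 0 := lt_lim_aux (by norm_num)
      (cX.mono (fun t ht => ⟨lt_of_lt_of_le (by norm_num) ht.1, ht.2⟩))
      (fun r hr => dX r ⟨lt_trans (by norm_num) hr.1, hr.2⟩)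
      (fun r hr => Xpos_deriv r ⟨lt_trans (by norm_num) hr.1, hr.2⟩
        (hWneg r ⟨lt_trans (by norm_num) hr.1, hr.2⟩)) limX2
  linarith

theorem RS.unique {l b c : ℝ} {y z Y Z : ℝ → ℝ} (h : RS l b y z) (H : RS l c Y Z)
    (hb : 0 ≤ b) (hc : 0 ≤ c) (hz : z 1 = 1) (hZ : Z 1 = 1)
    (hy : ∀ r ∈ Ioo (1:ℝ) 2, 0 < y r) (hY : ∀ r ∈ Ioo (1:ℝ) 2, 0 < Y r)
    (hy2 : y 2 = 0) (hY2 : Y 2 = 0) : b = c := by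
  rcases lt_trichotomy b c with h1 | h1 | h1
  · exact (h.unique_aux H hb h1 hz hZ hy hY hy2 hY2).elim
  · exact h1
  · exact (H.unique_aux h hc h1 hZ hz hY hy hY2 hy2).elim

theorem prim_aux {f : ℝ → ℝ} {a b : ℝ} (hab : a ≤ b) (hf : ContinuousOn f (Icc a b)) :
    ContinuousOn (fun r => ∫ t in a..r, f t) (Icc a b) ∧
    ∀ r ∈ Ioo a b, HasDerivAt (fun r => ∫ t in a..r, f t) (f r) r := by
  have hi : IntervalIntegrable f volume a b := by
    apply ContinuousOn.intervalIntegrable; rwa [uIcc_of_le hab]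
  constructor
  · have := intervalIntegral.continuousOn_primitive_interval' hi (left_mem_uIcc)
    rwa [uIcc_of_le hab] at this
  · intro r hr
    apply intervalIntegral.integral_hasDerivAt_right
    · apply hi.mono_set
      rw [uIcc_of_le hab, uIcc_of_le hr.1.le]
      exact Icc_subset_Icc_right hr.2.le
    · exact (hf.mono Ioo_subset_Icc_self).stronglyMeasurableAtFilter isOpen_Ioo r hr
    · exact hf.continuousAt (Icc_mem_nhds hr.1 hr.2)

theorem quad_deriv {u : ℝ → ℝ} {d m r : ℝ} (hm : 0 < m) (hd : HasDerivAt u d r)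
    (h0 : 0 < u r) (h1 : u r < m) :
    HasDerivAt (fun r => Real.sqrt (m ^ 2 - u r ^ 2) / m)
      (-(u r * d / (m * Real.sqrt (m ^ 2 - u r ^ 2)))) r := by
  have hp : 0 < m ^ 2 - u r ^ 2 := by nlinarith
  have hs : 0 < Real.sqrt (m ^ 2 - u r ^ 2) := Real.sqrt_pos.2 hp
  have := (((hd.pow 2).const_sub (m ^ 2)).sqrt hp.ne').div_const m
  refine this.congr_deriv ?_
  simp only [Pi.pow_apply]
  field_simp
  simp
  ring

theorem quad_ineq {x d m k : ℝ} (hm : 0 < m) (hk : 0 < k) (h0 : 0 < x) (h1 : x < m)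
    (h : x ^ 2 * (m ^ 2 - x ^ 2) * m ^ 2 ≤ k ^ 2 * d ^ 2) :
    x ^ 2 ≤ k * (x * |d| / (m * Real.sqrt (m ^ 2 - x ^ 2))) := by
  have hp : 0 < m ^ 2 - x ^ 2 := by nlinarith
  have hs : 0 < Real.sqrt (m ^ 2 - x ^ 2) := Real.sqrt_pos.2 hp
  have hss : Real.sqrt (m ^ 2 - x ^ 2) ^ 2 = m ^ 2 - x ^ 2 := Real.sq_sqrt hp.le
  set S := Real.sqrt (m ^ 2 - x ^ 2)
  have h2 : x * m * S ≤ k * |d| := by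
    apply le_of_sq_le_sq
    · have : (k * |d|) ^ 2 = k ^ 2 * d ^ 2 := by rw [mul_pow, sq_abs]
      rw [this]
      calc (x * m * S) ^ 2 = x ^ 2 * S ^ 2 * m ^ 2 := by ring
        _ ≤ _ := by rw [hss]; exact h
    · positivity
  rw [mul_div_assoc', le_div_iff₀ (by positivity)]
  nlinarith

theorem quad_anti {u du : ℝ → ℝ} {a b m k : ℝ} (hab : a ≤ b) (hm : 0 < m) (hk : 0 < k)
    (hc : ContinuousOn u (Icc a b)) (hd : ∀ r ∈ Ioo a b, HasDerivAt u (du r) r)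
    (h0 : ∀ r ∈ Ioo a b, 0 < u r) (h1 : ∀ r ∈ Ioo a b, u r < m)
    (hi : ∀ r ∈ Ioo a b, u r ^ 2 * (m ^ 2 - u r ^ 2) * m ^ 2 ≤ k ^ 2 * du r ^ 2)
    (hs : (∀ r ∈ Ioo a b, du r ≤ 0) ∨ (∀ r ∈ Ioo a b, 0 ≤ du r)) :
    ∫ r in a..b, u r ^ 2 ≤ k := by
  obtain ⟨pc, pd⟩ := prim_aux hab (hc.pow 2)
  have hle1 : ∀ r, Real.sqrt (m ^ 2 - u r ^ 2) / m ≤ 1 := by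
    intro r
    rw [div_le_one hm]
    calc Real.sqrt (m ^ 2 - u r ^ 2) ≤ Real.sqrt (m ^ 2) :=
          Real.sqrt_le_sqrt (by nlinarith [sq_nonneg (u r)])
      _ = m := Real.sqrt_sq hm.le
  have hge0 : ∀ r, 0 ≤ Real.sqrt (m ^ 2 - u r ^ 2) / m := fun r => by positivity
  have hcs : ContinuousOn (fun r => Real.sqrt (m ^ 2 - u r ^ 2) / m) (Icc a b) :=
    ((continuousOn_const.sub (hc.pow 2)).sqrt).div_const m
  rcases hs with hs | hs
  · have hmono := mono_aux (f := fun r => k * (Real.sqrt (m ^ 2 - u r ^ 2) / m) - ∫ t in a..r, u t ^ 2)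
      (hcs.const_smul k |>.sub pc)
      (fun r hr => ((quad_deriv hm (hd r hr) (h0 r hr) (h1 r hr)).const_mul k).sub (pd r hr))
      (fun r hr => by
        have := quad_ineq hm hk (h0 r hr) (h1 r hr) (hi r hr)
        rw [abs_of_nonpos (hs r hr)] at this
        simp only [Pi.pow_apply]
        have e : k * (u r * -du r / (m * Real.sqrt (m ^ 2 - u r ^ 2))) =
          k * -(u r * du r / (m * Real.sqrt (m ^ 2 - u r ^ 2))) := by ring
        linarith)
    have := hmono ⟨le_rfl, hab⟩ ⟨hab, le_rfl⟩ hab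
    simp only [intervalIntegral.integral_same] at this
    have e1 := mul_le_mul_of_nonneg_left (hle1 b) hk.le
    have e2 := mul_nonneg hk.le (hge0 a)
    linarith
  · have hmono := anti_aux (f := fun r => k * (Real.sqrt (m ^ 2 - u r ^ 2) / m) + ∫ t in a..r, u t ^ 2)
      (hcs.const_smul k |>.add pc)
      (fun r hr => ((quad_deriv hm (hd r hr) (h0 r hr) (h1 r hr)).const_mul k).add (pd r hr))
      (fun r hr => by
        have := quad_ineq hm hk (h0 r hr) (h1 r hr) (hi r hr)
        rw [abs_of_nonneg (hs r hr)] at this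
        simp only [Pi.pow_apply]
        linarith)
    have := hmono ⟨le_rfl, hab⟩ ⟨hab, le_rfl⟩ hab
    simp only [intervalIntegral.integral_same] at this
    have e1 := mul_le_mul_of_nonneg_left (hle1 a) hk.le
    have e2 := mul_nonneg hk.le (hge0 b)
    linarith

/-- Universal bound of the mass of positive solutions. -/
theorem RS.mass_bound {l : ℝ} {u ζ : ℝ → ℝ} (h : RS l 1 u ζ)
    (hu : ∀ r ∈ Ioo (1:ℝ) 2, 0 < u r) (hu2 : u 2 = 0) :
    ∫ r in (1:ℝ)..2, u r ^ 2 * r ≤ 18 := by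
  have hcr : ContinuousOn (fun r : ℝ => r) (Icc 1 2) := continuousOn_id
  have hrne : ∀ r ∈ Icc (1:ℝ) 2, 2 * r ^ 2 ≠ 0 := by
    intro r hr; have := hr.1; positivity
  set e : ℝ → ℝ := fun r => ζ r ^ 2 / (2 * r ^ 2) + u r ^ 6 / 6 - l * u r ^ 2 / 2 with he
  have ce : ContinuousOn e (Icc 1 2) := by
    have h1 := h.cy
    have h2 := h.cz
    have h3 : ContinuousOn (fun r => ζ r ^ 2 / (2 * r ^ 2)) (Icc 1 2) :=
      (h2.pow 2).div (by fun_prop) hrne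
    simp only [he]
    fun_prop
  have de : ∀ r ∈ Ioo (1:ℝ) 2, HasDerivAt e (-(ζ r ^ 2 / r ^ 3)) r := by
    intro r hr
    have hr0 : (0:ℝ) < r := by linarith [hr.1]
    have h1 := h.dy r hr
    have h2 := h.dz r hr
    have h3 := (((h2.pow 2).div ((hasDerivAt_pow 2 r).const_mul 2) (by positivity)).add
      ((h1.pow 6).div_const 6)).sub (((h1.pow 2).const_mul l).div_const 2)
    refine h3.congr_deriv ?_
    simp only [Pi.pow_apply]
    field_simp
    ring
  have ea : AntitoneOn e (Icc 1 2) := anti_aux ce de (fun r hr => by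
    have : (0:ℝ) < r := by linarith [hr.1]
    have : 0 ≤ ζ r ^ 2 / r ^ 3 := by positivity
    linarith)
  have e2 : 0 ≤ e 2 := by simp only [he, hu2]; norm_num; positivity
  have ge0 : ∀ r ∈ Icc (1:ℝ) 2, 0 ≤ e r := fun r hr => e2.trans (ea hr (by simp) hr.2)
  have crit : ∀ r ∈ Ioo (1:ℝ) 2, ζ r = 0 → 3 * l ≤ u r ^ 4 := by
    intro r hr hz
    have h1 := ge0 r ⟨hr.1.le, hr.2.le⟩
    simp only [he, hz] at h1
    have hp := hu r hr
    have : 0 ≤ u r ^ 2 * (u r ^ 4 - 3 * l) := by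
      have : u r ^ 2 * (u r ^ 4 - 3 * l) = 6 * (0 ^ 2 / (2 * r ^ 2) + u r ^ 6 / 6 - l * u r ^ 2 / 2) := by
        ring
      rw [this]; positivity
    have := nonneg_of_mul_nonneg_right this (by positivity)
    linarith
  have critd : ∀ r ∈ Ioo (1:ℝ) 2, 3 * l ≤ u r ^ 4 → r * (l * u r - 1 * u r ^ 5) < 0 := by
    intro r hr h3
    have hp := hu r hr
    have hr0 : (0:ℝ) < r := by linarith [hr.1]
    have : l * u r - 1 * u r ^ 5 = u r * (l - u r ^ 4) := by ring
    rw [this]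
    have h4 : 0 < u r ^ 4 := by positivity
    refine mul_neg_of_pos_of_neg hr0 (mul_neg_of_pos_of_neg hp (by linarith))
  have hump0 : ∀ s ∈ Ioo (1:ℝ) 2, ζ s ≤ 0 → ∀ r ∈ Ioo s 2, ζ r ≤ 0 := by
    intro s hs hz r hr
    have := image_le_of_deriv_right_lt_deriv_boundary (f := ζ)
      (f' := fun r => r * (l * u r - 1 * u r ^ 5)) (a := s) (b := r)
      (h.cz.mono (Icc_subset_Icc hs.1.le hr.2.le))
      (fun x hx => (h.dz x ⟨hs.1.trans_le hx.1, hx.2.trans hr.2⟩).hasDerivWithinAt)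
      (B := fun _ => 0) (B' := fun _ => 0) hz (fun x => hasDerivAt_const _ _)
      (fun x hx hx0 => critd x ⟨hs.1.trans_le hx.1, hx.2.trans hr.2⟩
        (crit x ⟨hs.1.trans_le hx.1, hx.2.trans hr.2⟩ hx0))
    exact this ⟨hr.1.le, le_rfl⟩
  have hump : ∀ s ∈ Ioo (1:ℝ) 2, ζ s ≤ 0 → ∀ r ∈ Ioo s 2, ζ r < 0 := by
    intro s hs hz r hr
    refine lt_of_le_of_ne (hump0 s hs hz r hr) ?_
    intro h0
    have hrI : r ∈ Ioo (1:ℝ) 2 := ⟨hs.1.trans hr.1, hr.2⟩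
    have hmax : IsLocalMax ζ r := by
      filter_upwards [Ioo_mem_nhds hr.1 hr.2] with x hx
      rw [h0]; exact hump0 s hs hz x hx
    have := hmax.hasDerivAt_eq_zero (h.dz r hrI)
    have h9 := critd r hrI (crit r hrI h0)
    linarith
  obtain ⟨ρ, hρ, hmax⟩ := isCompact_Icc.exists_isMaxOn (nonempty_Icc.2 (by norm_num : (1:ℝ) ≤ 2)) h.cy
  have hmax' : ∀ r ∈ Icc (1:ℝ) 2, u r ≤ u ρ := fun r hr => hmax hr
  have hM : 0 < u ρ := (hu (3/2) (by norm_num)).trans_le (hmax' _ (by norm_num))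
  have hρI : ρ ∈ Ioo (1:ℝ) 2 := by
    refine ⟨lt_of_le_of_ne hρ.1 ?_, lt_of_le_of_ne hρ.2 ?_⟩
    · intro hc; rw [← hc, h.y1] at hM; exact lt_irrefl _ hM
    · intro hc; rw [hc, hu2] at hM; exact lt_irrefl _ hM
  have hρ0 : ρ ≠ 0 := by have := hρI.1; linarith
  have hζρ : ζ ρ = 0 := by
    have : IsLocalMax u ρ := by
      filter_upwards [Icc_mem_nhds hρI.1 hρI.2] with x hx
      exact hmax' x hx
    have := this.hasDerivAt_eq_zero (h.dy ρ hρI)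
    rcases div_eq_zero_iff.1 this with h | h
    · exact h
    · exact absurd h hρ0
  have hM4 : 3 * l ≤ u ρ ^ 4 := crit ρ hρI hζρ
  have hpos : ∀ r ∈ Ioo 1 ρ, 0 < ζ r := by
    intro r hr
    by_contra hc
    push Not at hc
    have := hump r ⟨hr.1, hr.2.trans hρI.2⟩ hc ρ ⟨hr.2, hρI.2⟩
    linarith
  have hneg : ∀ r ∈ Ioo ρ 2, ζ r < 0 := hump ρ hρI hζρ.le
  have hlt1 : ∀ r ∈ Ioo 1 ρ, u r < u ρ := by
    intro r hr
    have := smono_aux (f := u) (a := 1) (b := ρ) (h.cy.mono (Icc_subset_Icc_right hρ.2))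
      (fun r hr => h.dy r ⟨hr.1, hr.2.trans hρI.2⟩)
      (fun r hr => div_pos (hpos r hr) (by linarith [hr.1]))
    exact this ⟨hr.1.le, hr.2.le⟩ ⟨hρ.1, le_rfl⟩ hr.2
  have uanti : StrictAntiOn u (Icc ρ 2) := santi_aux (h.cy.mono (Icc_subset_Icc_left hρ.1))
      (fun r hr => h.dy r ⟨hρI.1.trans hr.1, hr.2⟩)
      (fun r hr => div_neg_of_neg_of_pos (hneg r hr) (by linarith [hr.1, hρI.1]))
  set M := u ρ with hMdef
  have A : ∫ r in (1:ℝ)..ρ, u r ^ 2 ≤ 2 := by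
    refine quad_anti (du := fun r => ζ r / r) hρ.1 hM (by norm_num)
      (h.cy.mono (Icc_subset_Icc_right hρ.2)) (fun r hr => h.dy r ⟨hr.1, hr.2.trans hρI.2⟩)
      (fun r hr => hu r ⟨hr.1, hr.2.trans hρI.2⟩) hlt1 ?_ (Or.inr ?_)
    · intro r hr
      have h1 := ea (a := r) (b := ρ) ⟨hr.1.le, hr.2.le.trans hρ.2⟩ hρ hr.2.le
      simp only [he, hζρ] at h1
      rw [← hMdef] at h1
      have hp := hu r ⟨hr.1, hr.2.trans hρI.2⟩
      have hl := hlt1 r hr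
      have hr0 : 0 < r := by linarith [hr.1]
      have e1 : (ζ r / r) ^ 2 = 2 * (ζ r ^ 2 / (2 * r ^ 2)) := by field_simp
      have h2 : M ^ 6 / 3 - l * M ^ 2 - u r ^ 6 / 3 + l * u r ^ 2 ≤ (ζ r / r) ^ 2 := by
        rw [e1]
        have : (0:ℝ) ^ 2 / (2 * ρ ^ 2) = 0 := by simp
        rw [this] at h1
        linarith
      have hd : 0 < M ^ 2 - u r ^ 2 := by nlinarith
      have h3 : 0 ≤ (M ^ 2 - u r ^ 2) * (M ^ 4 / 3 - l) := mul_nonneg hd.le (by linarith)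
      have h4 : 0 ≤ (M ^ 2 - u r ^ 2) * u r ^ 4 := by positivity
      have h5 : 0 ≤ (M ^ 2 - u r ^ 2) * (u r ^ 2 * M ^ 2) := by positivity
      nlinarith
    · intro r hr
      exact div_nonneg (hpos r hr).le (by linarith [hr.1])
  have B : ∀ σ ∈ Icc ρ 2, (∀ r ∈ Ioo ρ σ, 3 * l ≤ u r ^ 4) → ∫ r in ρ..σ, u r ^ 2 ≤ 5 := by
    intro σ hσ hσl
    have hd : ∀ r ∈ Ioo ρ σ, r ∈ Ioo (1:ℝ) 2 := fun r hr => ⟨hρI.1.trans hr.1, hr.2.trans_le hσ.2⟩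
    have hlt2 : ∀ r ∈ Ioo ρ σ, u r < M := fun r hr =>
      uanti ⟨le_rfl, hρ.2⟩ ⟨hr.1.le, hr.2.le.trans hσ.2⟩ hr.1
    have hmon := mono_aux (f := fun r => ζ r ^ 2 + 2 / 9 * u r ^ 6)
      (f' := fun r => 2 * ζ r * (r * (l * u r - 1 * u r ^ 5) + 2 / 3 * u r ^ 5 / r)) (a := ρ) (b := σ)
      (by
        have h1 := h.cy.mono (Icc_subset_Icc hρ.1 hσ.2)
        have h2 := h.cz.mono (Icc_subset_Icc hρ.1 hσ.2)
        fun_prop)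
      (by
        intro r hr
        have hr0 : r ≠ 0 := by linarith [(hd r hr).1]
        have := ((h.dz r (hd r hr)).pow 2).add (((h.dy r (hd r hr)).pow 6).const_mul (2/9))
        refine this.congr_deriv ?_
        field_simp
        ring)
      (by
        intro r hr
        have h1 : ζ r < 0 := hneg r ⟨hr.1, hr.2.trans_le hσ.2⟩
        have hr1 := (hd r hr).1
        have hp := hu r (hd r hr)
        have hl := hσl r hr
        have h2 : r * (l * u r - 1 * u r ^ 5) + 2 / 3 * u r ^ 5 / r ≤ 0 := by
          have h5 : 0 < u r ^ 5 := by positivity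
          have e1 : 2 / 3 * u r ^ 5 / r ≤ 2 / 3 * u r ^ 5 := by
            apply div_le_self (by positivity) hr1.le
          have e2 : l * u r - 1 * u r ^ 5 ≤ - (2 / 3 * u r ^ 5) := by
            have : l * u r ≤ u r ^ 4 / 3 * u r := by
              apply mul_le_mul_of_nonneg_right _ hp.le; linarith
            nlinarith
          nlinarith
        nlinarith)
    refine quad_anti (du := fun r => ζ r / r) hσ.1 hM (by norm_num)
      (h.cy.mono (Icc_subset_Icc hρ.1 hσ.2)) (fun r hr => h.dy r (hd r hr))
      (fun r hr => hu r (hd r hr)) hlt2 ?_ (Or.inl ?_)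
    · intro r hr
      have h1 := hmon ⟨le_rfl, hσ.1⟩ ⟨hr.1.le, hr.2.le⟩ hr.1.le
      simp only [hζρ] at h1
      rw [← hMdef] at h1
      have hp := hu r (hd r hr)
      have hl := hlt2 r hr
      have hr0 : 0 < r := by linarith [(hd r hr).1]
      have hr2 := (hd r hr).2
      have h2 : ζ r ^ 2 / 4 ≤ (ζ r / r) ^ 2 := by
        rw [div_pow]
        apply div_le_div_of_nonneg_left (sq_nonneg _) (by positivity)
        nlinarith
      have hd : 0 < M ^ 2 - u r ^ 2 := by nlinarith
      have h3 : 0 ≤ (M ^ 2 - u r ^ 2) * M ^ 4 := by positivity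
      have h4 : 0 ≤ (M ^ 2 - u r ^ 2) * u r ^ 4 := by positivity
      have h5 : 0 ≤ (M ^ 2 - u r ^ 2) * (u r ^ 2 * M ^ 2) := by positivity
      nlinarith
    · intro r hr
      exact div_nonpos_of_nonpos_of_nonneg (hneg r ⟨hr.1, hr.2.trans_le hσ.2⟩).le
        (by linarith [(hd r hr).1])
  have ii : ∀ a b, a ∈ Icc (1:ℝ) 2 → b ∈ Icc (1:ℝ) 2 →
      IntervalIntegrable (fun r => u r ^ 2) volume a b := by
    intro a b ha hb
    apply ContinuousOn.intervalIntegrable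
    exact (h.cy.pow 2).mono (uIcc_subset_Icc ha hb)
  have D : ∫ r in ρ..2, u r ^ 2 ≤ 7 := by
    rcases le_or_gt l 0 with hl | hl
    · have := B 2 ⟨hρ.2, le_rfl⟩ (fun r hr => by
        have : 0 ≤ u r ^ 4 := by positivity
        linarith)
      linarith
    · set q := Real.sqrt (Real.sqrt (3 * l)) with hq
      have hq0 : 0 < q := Real.sqrt_pos.2 (Real.sqrt_pos.2 (by linarith))
      have hq4 : q ^ 4 = 3 * l := by
        have : q ^ 4 = (q ^ 2) ^ 2 := by ring
        rw [this, hq, Real.sq_sqrt (Real.sqrt_nonneg _), Real.sq_sqrt (by linarith)]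
      have hqM : q ≤ M := by
        by_contra hc
        push Not at hc
        have : M ^ 4 < q ^ 4 := by gcongr
        linarith
      obtain ⟨σ, hσ, hσq⟩ : ∃ σ ∈ Icc ρ 2, u σ = q := by
        have := intermediate_value_Icc' hρ.2 (h.cy.mono (Icc_subset_Icc_left hρ.1))
        obtain ⟨σ, h1, h2⟩ := this (show q ∈ Icc (u 2) (u ρ) from ⟨by rw [hu2]; exact hq0.le, hqM⟩)
        exact ⟨σ, h1, h2⟩
      have hσI : σ ∈ Icc (1:ℝ) 2 := ⟨hρ.1.trans hσ.1, hσ.2⟩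
      have B' := B σ hσ (fun r hr => by
        have : q < u r := by
          rw [← hσq]
          exact uanti ⟨hr.1.le, hr.2.le.trans hσ.2⟩ hσ hr.2
        rw [← hq4]; gcongr)
      have hlt3 : ∀ r ∈ Ioo σ 2, u r < q := by
        intro r hr
        rw [← hσq]
        exact uanti hσ ⟨hσ.1.trans hr.1.le, hr.2.le⟩ hr.1
      have C : ∫ r in σ..2, u r ^ 2 ≤ 2 := by
        refine quad_anti (du := fun r => ζ r / r) hσ.2 hq0 (by norm_num)
          (h.cy.mono (Icc_subset_Icc_left hσI.1)) (fun r hr => h.dy r ⟨hσI.1.trans_lt hr.1, hr.2⟩)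
          (fun r hr => hu r ⟨hσI.1.trans_lt hr.1, hr.2⟩) hlt3 ?_ (Or.inl ?_)
        · intro r hr
          have hrI : r ∈ Ioo (1:ℝ) 2 := ⟨hσI.1.trans_lt hr.1, hr.2⟩
          have h1 := ge0 r ⟨hrI.1.le, hrI.2.le⟩
          simp only [he] at h1
          have hp := hu r hrI
          have hl := hlt3 r hr
          have hr0 : 0 < r := by linarith [hrI.1]
          have e1 : (ζ r / r) ^ 2 = 2 * (ζ r ^ 2 / (2 * r ^ 2)) := by field_simp
          have h2 : l * u r ^ 2 - u r ^ 6 / 3 ≤ (ζ r / r) ^ 2 := by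
            rw [e1]
            linarith
          have hl' : l = q ^ 4 / 3 := by linarith
          rw [hl'] at h2
          have hd : 0 < q ^ 2 - u r ^ 2 := by nlinarith
          have h4 : 0 ≤ (q ^ 2 - u r ^ 2) * u r ^ 4 := by positivity
          have h5 : 0 ≤ (q ^ 2 - u r ^ 2) * (u r ^ 2 * q ^ 2) := by positivity
          nlinarith
        · intro r hr
          exact div_nonpos_of_nonpos_of_nonneg (hneg r ⟨hσ.1.trans_lt hr.1, hr.2⟩).le
            (by linarith [hσI.1, hr.1])
      have := intervalIntegral.integral_add_adjacent_intervals (ii ρ σ hρ hσI) (ii σ 2 hσI (by simp))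
      linarith
  have tot := intervalIntegral.integral_add_adjacent_intervals (ii 1 ρ (by simp) hρ) (ii ρ 2 hρ (by simp))
  have fin : ∫ r in (1:ℝ)..2, u r ^ 2 * r ≤ ∫ r in (1:ℝ)..2, 2 * u r ^ 2 := by
    apply intervalIntegral.integral_mono_on (by norm_num)
    · apply ContinuousOn.intervalIntegrable
      rw [uIcc_of_le (by norm_num)]
      exact (h.cy.pow 2).mul hcr
    · exact (ii 1 2 (by simp) (by simp)).const_mul 2
    · intro r hr
      nlinarith [sq_nonneg (u r), hr.2]
  rw [intervalIntegral.integral_const_mul] at fin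
  linarith

theorem RS.sturm {l b : ℝ} {y z : ℝ → ℝ} (h : RS l b y z) {p q : ℝ} (hp : 1 ≤ p) (hpq : p < q)
    (hq : q ≤ 2) (h0 : ∀ r ∈ Icc (1:ℝ) 2, 0 ≤ y r) (hpos : ∀ r ∈ Ioo p q, 0 < y r) :
    ∃ r ∈ Ioo p q, b * y r ^ 4 ≤ l + (Real.pi / Real.log (q / p)) ^ 2 := by
  by_contra hcon
  push Not at hcon
  have hp0 : 0 < p := by linarith
  have hlog : 0 < Real.log (q / p) := Real.log_pos (by rw [lt_div_iff₀ hp0]; linarith)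
  set c := Real.pi / Real.log (q / p) with hc
  have hc0 : 0 < c := by positivity
  have hsub : Icc p q ⊆ Icc (1:ℝ) 2 := Icc_subset_Icc hp hq
  have hsub' : Ioo p q ⊆ Ioo (1:ℝ) 2 := Ioo_subset_Ioo hp hq
  have cl : ContinuousOn (fun r => c * Real.log (r / p)) (Icc p q) := by
    apply ContinuousOn.mul continuousOn_const
    apply ContinuousOn.log (by fun_prop)
    intro r hr
    have : 0 < r := by linarith [hr.1]
    positivity
  have dl : ∀ r ∈ Ioo p q, HasDerivAt (fun r => c * Real.log (r / p)) (c / r) r := by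
    intro r hr
    have hr0 : 0 < r := by linarith [hr.1]
    have := (((hasDerivAt_id r).div_const p).log (by simp; exact ⟨hr0.ne', hp0.ne'⟩)).const_mul c
    refine this.congr_deriv ?_
    simp
    field_simp
  have hs : StrictAntiOn (fun r => z r * Real.sin (c * Real.log (r / p)) -
      y r * (c * Real.cos (c * Real.log (r / p)))) (Icc p q) := by
    apply santi_aux (f' := fun r => Real.sin (c * Real.log (r / p)) * y r *
      (r * l - r * b * y r ^ 4 + c ^ 2 / r))
    · exact ((h.cz.mono hsub).mul (Real.continuous_sin.comp_continuousOn cl)).sub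
        ((h.cy.mono hsub).mul (continuousOn_const.mul (Real.continuous_cos.comp_continuousOn cl)))
    · intro r hr
      have hr0 : 0 < r := by linarith [hr.1]
      have := ((h.dz r (hsub' hr)).mul (dl r hr).sin).sub
        ((h.dy r (hsub' hr)).mul ((dl r hr).cos.const_mul c))
      refine this.congr_deriv ?_
      field_simp
      ring
    · intro r hr
      have hr0 : 1 < r := by linarith [hr.1]
      have hy := hpos r hr
      have hsin : 0 < Real.sin (c * Real.log (r / p)) := by
        apply Real.sin_pos_of_pos_of_lt_pi
        · have : 0 < Real.log (r / p) := Real.log_pos (by rw [lt_div_iff₀ hp0]; linarith [hr.1])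
          positivity
        · have : Real.log (r / p) < Real.log (q / p) := by
            apply Real.log_lt_log (by positivity)
            exact div_lt_div_of_pos_right hr.2 hp0
          rw [hc, div_mul_eq_mul_div, div_lt_iff₀ hlog]
          exact mul_lt_mul_of_pos_left this Real.pi_pos
      have h1 := hcon r hr
      have h2 : c ^ 2 / r ≤ r * c ^ 2 := by
        rw [div_le_iff₀ (by linarith)]
        nlinarith [mul_nonneg (sq_nonneg c) (by nlinarith : 0 ≤ r * r - 1)]
      have : r * l - r * b * y r ^ 4 + c ^ 2 / r < 0 := by
        have := mul_lt_mul_of_pos_left h1 (by linarith : 0 < r)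
        nlinarith
      exact mul_neg_of_pos_of_neg (by positivity) this
  have := hs ⟨le_rfl, hpq.le⟩ ⟨hpq.le, le_rfl⟩ hpq
  simp only [div_self hp0.ne', Real.log_one, mul_zero, Real.sin_zero, Real.cos_zero, zero_sub] at this
  rw [hc, div_mul_cancel₀ _ hlog.ne', Real.sin_pi, Real.cos_pi, ← hc] at this
  have a1 := mul_nonneg (h0 p ⟨hp, by linarith⟩) hc0.le
  have a2 := mul_nonneg (h0 q ⟨by linarith, hq⟩) hc0.le
  nlinarith

theorem RS.not_nonneg {l b : ℝ} {y z : ℝ → ℝ} (h : RS l b y z) (hb : 0 ≤ b) (hz : z 1 = 1)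
    (hl : l + (Real.pi / Real.log 2) ^ 2 < 0) : ¬ ∀ r ∈ Icc (1:ℝ) 2, 0 ≤ y r := by
  intro h0
  obtain ⟨r, hr, hh⟩ := h.sturm le_rfl (by norm_num) le_rfl h0
    (h.pos_of_nonneg (by rw [hz]; norm_num) h0)
  rw [div_one] at hh
  have : 0 ≤ b * y r ^ 4 := by positivity
  linarith

theorem RS.scale {l b a : ℝ} {y z : ℝ → ℝ} (h : RS l (a ^ 4 * b) y z) :
    RS l b (fun r => a * y r) (fun r => a * z r) where
  cy := continuousOn_const.mul h.cy
  cz := continuousOn_const.mul h.cz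
  dy := fun r hr => ((h.dy r hr).const_mul a).congr_deriv (by ring)
  dz := fun r hr => ((h.dz r hr).const_mul a).congr_deriv (by ring)
  y1 := by simp [h.y1]

set_option maxHeartbeats 1600000 in
/-- a priori bound -/
theorem RS.apriori_aux (L : ℝ) (hL : 1 ≤ L) : ∃ A : ℝ, ∀ (l : ℝ) (u ζ : ℝ → ℝ), |l| ≤ L → RS l 1 u ζ →
    (∀ r ∈ Icc (1:ℝ) 2, 0 ≤ u r) → 0 < ζ 1 → ζ 1 ≤ A := by
  set c := Real.pi / Real.log ((7/4) / (5/4))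
  set K := 1 + L + c ^ 2 with hK
  set D := 2 * L ^ 2 with hD
  set Z := 8 * K + D with hZ
  refine ⟨1 + 2 * (Z ^ 2 / 2 + 4 * (K ^ 6 / 6 + L * K ^ 2 / 2) + 4 * L ^ 2), ?_⟩
  intro l u ζ hl h h0 hα
  have hl' := abs_le.1 hl
  obtain ⟨r1, hr1, hu1⟩ := h.sturm (p := 5/4) (q := 7/4) (by norm_num) (by norm_num) (by norm_num) h0
    (fun r hr => h.pos_of_nonneg hα.ne' h0 r ⟨by linarith [hr.1], by linarith [hr.2]⟩)
  have hr1m : r1 ∈ Icc (1:ℝ) 2 := ⟨by linarith [hr1.1], by linarith [hr1.2]⟩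
  have hu0 := h0 r1 hr1m
  have hK1 : 1 ≤ K := by nlinarith [sq_nonneg c]
  have huK : u r1 ≤ K := by
    by_contra hcc
    push Not at hcc
    have h1 : 1 ≤ u r1 := by linarith
    have h2 : u r1 ≤ u r1 ^ 4 := le_self_pow₀ h1 (by norm_num)
    change 1 * u r1 ^ 4 ≤ l + c ^ 2 at hu1
    linarith
  have hanti : AntitoneOn (fun r => ζ r - D * r) (Icc 1 2) := by
    apply anti_aux (f' := fun r => r * (l * u r - 1 * u r ^ 5) - D)
    · exact h.cz.sub (by fun_prop)
    · intro r hr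
      exact ((h.dz r hr).sub ((hasDerivAt_id r).const_mul D)).congr_deriv (by ring)
    · intro r hr
      have hu := h0 r ⟨hr.1.le, hr.2.le⟩
      have : l * u r - 1 * u r ^ 5 ≤ L ^ 2 := by
        rcases le_or_gt (u r) L with hc | hc
        · have : l * u r ≤ L * L := mul_le_mul hl'.2 hc hu (by linarith)
          have : 0 ≤ u r ^ 5 := by positivity
          nlinarith
        · have h2 : u r ≤ u r ^ 4 := le_self_pow₀ (by linarith) (by norm_num)
          have h3 : l * u r ≤ u r ^ 4 * u r := mul_le_mul_of_nonneg_right (by linarith) hu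
          nlinarith
      have hr0 : 0 < r := by linarith [hr.1]
      have : r * (l * u r - 1 * u r ^ 5) ≤ r * L ^ 2 := mul_le_mul_of_nonneg_left this hr0.le
      have h3 : r * L ^ 2 ≤ 2 * L ^ 2 := mul_le_mul_of_nonneg_right hr.2.le (sq_nonneg L)
      rw [hD]; linarith
  have hD0 : 0 ≤ D := by positivity
  have hlow : -Z ≤ ζ r1 := by
    by_contra hcc
    push Not at hcc
    have := anti_aux (f := fun r => u r - (ζ r1 + D) / 2 * r) (f' := fun r => ζ r / r - (ζ r1 + D) / 2)
      (a := r1) (b := 2) ((h.cy.mono (Icc_subset_Icc_left hr1m.1)).sub (by fun_prop))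
      (fun r hr => ((h.dy r ⟨by linarith [hr.1, hr1m.1], hr.2⟩).sub
        ((hasDerivAt_id r).const_mul _)).congr_deriv (by ring))
      (fun r hr => by
        have hrm : r ∈ Icc (1:ℝ) 2 := ⟨by linarith [hr.1, hr1m.1], hr.2.le⟩
        have h1 := hanti hr1m hrm hr.1.le
        simp only at h1
        have hr0 : 0 < r := by linarith [hrm.1]
        have h2 : ζ r ≤ ζ r1 + D := by nlinarith [hr.1, hr.2, hr1m.1]
        have h3 : ζ r / r ≤ (ζ r1 + D) / 2 := by
          rw [div_le_iff₀ hr0]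
          nlinarith [hr.2]
        linarith)
    have := this ⟨le_rfl, hr1m.2⟩ ⟨hr1m.2, le_rfl⟩ hr1m.2
    simp only at this
    have h2 := h0 2 (by norm_num)
    nlinarith [hr1.2, mul_nonneg (by linarith : 0 ≤ -(ζ r1 + D)) (by linarith [hr1.2] : 0 ≤ 7/4 - r1)]
  have hup : ζ r1 ≤ Z := by
    by_contra hcc
    push Not at hcc
    have := mono_aux (f := fun r => u r - (ζ r1 - D) / 2 * r) (f' := fun r => ζ r / r - (ζ r1 - D) / 2)
      (a := 1) (b := r1) ((h.cy.mono (Icc_subset_Icc_right hr1m.2)).sub (by fun_prop))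
      (fun r hr => ((h.dy r ⟨hr.1, by linarith [hr.2, hr1m.2]⟩).sub
        ((hasDerivAt_id r).const_mul _)).congr_deriv (by ring))
      (fun r hr => by
        have hrm : r ∈ Icc (1:ℝ) 2 := ⟨hr.1.le, by linarith [hr.2, hr1m.2]⟩
        have h1 := hanti hrm hr1m hr.2.le
        simp only at h1
        have hr0 : 0 < r := by linarith [hrm.1]
        have h2 : ζ r1 - D ≤ ζ r := by nlinarith [hr.1, hr.2, hr1m.2]
        have h3 : (ζ r1 - D) / 2 ≤ ζ r / r := by
          rw [le_div_iff₀ hr0]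
          nlinarith [hrm.2]
        linarith)
    have := this ⟨le_rfl, hr1m.1⟩ ⟨hr1m.1, le_rfl⟩ hr1m.1
    simp only [h.y1] at this
    nlinarith [hr1.1, mul_nonneg (by linarith : 0 ≤ ζ r1 - D) (by linarith [hr1.1] : 0 ≤ r1 - 5/4)]
  have he := mono_aux (f := fun r => ζ r ^ 2 / 2 + r ^ 2 * (u r ^ 6 / 6 - l * u r ^ 2 / 2) + 4 * L ^ 2 * r)
    (f' := fun r => r * (u r ^ 6 / 3 - l * u r ^ 2) + 4 * L ^ 2) (a := 1) (b := 2)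
    ((((h.cz.pow 2).div_const 2).add ((by fun_prop : ContinuousOn (fun r : ℝ => r ^ 2) (Icc 1 2)).mul
      (((h.cy.pow 6).div_const 6).sub ((continuousOn_const.mul (h.cy.pow 2)).div_const 2)))).add (by fun_prop))
    (fun r hr => by
      have hr0 : 0 < r := by linarith [hr.1]
      have := ((((h.dz r hr).pow 2).div_const 2).add (((hasDerivAt_id r).pow 2).mul
        ((((h.dy r hr).pow 6).div_const 6).sub ((((h.dy r hr).pow 2).const_mul l).div_const 2)))).add
        ((hasDerivAt_id r).const_mul (4 * L ^ 2))
      refine this.congr_deriv ?_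
      simp
      field_simp
      ring)
    (fun r hr => by
      have hr0 : 0 < r := by linarith [hr.1]
      have : -(2 * L ^ 2) ≤ u r ^ 6 / 3 - l * u r ^ 2 := by
        have e : u r ^ 6 = (u r ^ 2) ^ 3 := by ring
        rw [e]
        have hx : 0 ≤ u r ^ 2 := sq_nonneg _
        generalize u r ^ 2 = x at hx
        have hlx : l * x ≤ L * x := mul_le_mul_of_nonneg_right hl'.2 hx
        rcases le_or_gt (3 * L) (x ^ 2) with hc | hc
        · have := mul_le_mul_of_nonneg_right hc hx
          nlinarith
        · have h3 : x ≤ 2 * L := by nlinarith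
          have := mul_le_mul_of_nonneg_left h3 (by linarith : 0 ≤ L)
          have : 0 ≤ x ^ 3 := by positivity
          nlinarith
      nlinarith [hr.2, sq_nonneg L])
  have := he ⟨le_rfl, by norm_num⟩ hr1m hr1m.1
  simp only [h.y1] at this
  have b1 : ζ r1 ^ 2 ≤ Z ^ 2 := sq_le_sq' hlow hup
  have b2 : u r1 ^ 6 ≤ K ^ 6 := pow_le_pow_left₀ hu0 huK 6
  have b3 : u r1 ^ 2 ≤ K ^ 2 := pow_le_pow_left₀ hu0 huK 2
  have b4 : u r1 ^ 6 / 6 - l * u r1 ^ 2 / 2 ≤ K ^ 6 / 6 + L * K ^ 2 / 2 := by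
    have : -l * u r1 ^ 2 ≤ L * K ^ 2 := mul_le_mul (by linarith) b3 (sq_nonneg _) (by linarith)
    linarith
  have b5 : r1 ^ 2 * (u r1 ^ 6 / 6 - l * u r1 ^ 2 / 2) ≤ 4 * (K ^ 6 / 6 + L * K ^ 2 / 2) := by
    have b0 : 0 ≤ K ^ 6 / 6 + L * K ^ 2 / 2 := by positivity
    calc _ ≤ r1 ^ 2 * (K ^ 6 / 6 + L * K ^ 2 / 2) := mul_le_mul_of_nonneg_left b4 (sq_nonneg _)
      _ ≤ _ := mul_le_mul_of_nonneg_right (by nlinarith [hr1m.1, hr1m.2]) b0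
  have b6 := mul_nonneg (sq_nonneg L) (by linarith [hr1m.2] : 0 ≤ 2 - r1)
  have b7 := sq_nonneg (ζ 1 - 1)
  norm_num at this
  linarith

theorem RS.apriori (L : ℝ) : ∃ B : ℝ, 0 ≤ B ∧ ∀ (l b : ℝ) (y z : ℝ → ℝ), |l| ≤ L → 0 ≤ b → RS l b y z →
    (∀ r ∈ Icc (1:ℝ) 2, 0 ≤ y r) → z 1 = 1 → b ≤ B := by
  obtain ⟨A, hA⟩ := RS.apriori_aux (max L 1) (le_max_right _ _)
  refine ⟨A ^ 4, by positivity, ?_⟩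
  intro l b y z hl hb h h0 hz
  rcases hb.eq_or_lt with rfl | hb
  · positivity
  set a := Real.sqrt (Real.sqrt b) with ha
  have ha0 : 0 < a := Real.sqrt_pos.2 (Real.sqrt_pos.2 hb)
  have ha4 : a ^ 4 = b := by
    have : a ^ 4 = (a ^ 2) ^ 2 := by ring
    rw [this, ha, Real.sq_sqrt (Real.sqrt_nonneg _), Real.sq_sqrt hb.le]
  have h' : RS l (a ^ 4 * 1) y z := by rw [ha4, mul_one]; exact h
  have := hA l _ _ (hl.trans (le_max_left _ _)) h'.scale
    (fun r hr => mul_nonneg ha0.le (h0 r hr)) (by simp [hz, ha0])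
  rw [hz, mul_one] at this
  rw [← ha4]
  exact pow_le_pow_left₀ ha0.le this 4

theorem RS.pos_gt {l m : ℝ} {y z Y Z : ℝ → ℝ} (h : RS l 0 y z) (H : RS m 0 Y Z) (hz : z 1 = 1)
    (hY : ∀ r ∈ Ioo (1:ℝ) 2, 0 < Y r) (hY2 : 0 ≤ Y 2) (hml : m < l) : ∀ r ∈ Ioc (1:ℝ) 2, 0 < y r := by
  by_contra hn
  obtain ⟨ρ, hρ, hpos, h0⟩ := h.firstZero (by rw [hz]; norm_num) hn
  have hzρ := h.z_nonpos hρ hpos h0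
  have hs := santi_aux (f := fun r => Z r * y r - Y r * z r) (a := 1) (b := ρ)
    ((RS.cwronskian h H).mono (Icc_subset_Icc_right hρ.2))
    (fun r hr => RS.wronskian h H (r := r) ⟨hr.1, by linarith [hr.2, hρ.2]⟩)
    (fun r hr => by
      have h1 := hpos r hr
      have h2 := hY r ⟨hr.1, by linarith [hr.2, hρ.2]⟩
      have h3 : 0 < r := by linarith [hr.1]
      simp only [zero_mul, sub_self, add_zero]
      exact mul_neg_of_pos_of_neg (by positivity) (by linarith))
  have := hs ⟨le_rfl, hρ.1.le⟩ ⟨hρ.1.le, le_rfl⟩ hρ.1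
  simp only [h.y1, H.y1, h0] at this
  have hYρ : 0 ≤ Y ρ := by
    rcases hρ.2.eq_or_lt with rfl | h2
    · exact hY2
    · exact (hY ρ ⟨hρ.1, h2⟩).le
  nlinarith

theorem RS.lt_of_pos {l b m : ℝ} {y z Y Z : ℝ → ℝ} (h : RS l b y z) (H : RS m 0 Y Z) (hb : 0 < b)
    (hy : ∀ r ∈ Ioo (1:ℝ) 2, 0 < y r) (hy2 : y 2 = 0)
    (hY : ∀ r ∈ Ioo (1:ℝ) 2, 0 < Y r) (hY2 : Y 2 = 0) : m < l := by
  by_contra hn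
  push Not at hn
  have hs := smono_aux (f := fun r => Z r * y r - Y r * z r) (a := 1) (b := 2)
    (RS.cwronskian h H)
    (fun r hr => RS.wronskian h H (r := r) hr)
    (fun r hr => by
      have h1 := hy r hr
      have h2 := hY r hr
      have h3 : 0 < r := by linarith [hr.1]
      have h4 : 0 < b * y r ^ 4 := by positivity
      have : 0 < (m - l) + (b * y r ^ 4 - 0 * Y r ^ 4) := by linarith
      positivity)
  have := hs ⟨le_rfl, by norm_num⟩ ⟨by norm_num, le_rfl⟩ (by norm_num)
  simp only [h.y1, H.y1, hy2, hY2] at this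
  linarith

/-- clamp -/
def clp (C x : ℝ) : ℝ := max (-C) (min x C)

theorem clp_abs {C x : ℝ} (hC : 0 ≤ C) : |clp C x| ≤ C := by
  unfold clp; rw [abs_le]
  exact ⟨le_max_left _ _, max_le (by linarith) (min_le_right _ _)⟩

theorem clp_lip (C x y : ℝ) : |clp C x - clp C y| ≤ |x - y| := by
  unfold clp
  calc |max (-C) (min x C) - max (-C) (min y C)| ≤ |min x C - min y C| := by
        have := abs_max_sub_max_le_abs (min x C) (min y C) (-C)
        rwa [max_comm _ (-C), max_comm _ (-C)] at this
    _ ≤ |x - y| := by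
        have := abs_min_sub_min_le_max x C y C
        simpa using this

theorem clp_cont (C : ℝ) : Continuous (clp C) := by
  unfold clp; fun_prop

theorem clp_nonneg {C x : ℝ} (hC : 0 ≤ C) (hx : 0 ≤ x) : 0 ≤ clp C x :=
  le_max_of_le_right (le_min hx hC)

theorem clp_le {C x : ℝ} (hC : 0 ≤ C) (hx : 0 ≤ x) : clp C x ≤ x :=
  max_le (by linarith) (min_le_left _ _)

theorem clp_le_max {C x : ℝ} (hC : 0 ≤ C) : clp C x ≤ max x 0 :=
  max_le (le_max_of_le_right (by linarith)) ((min_le_left _ _).trans (le_max_left _ _))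

theorem clp_eq {C x : ℝ} (hx : |x| ≤ C) : clp C x = x := by
  have := abs_le.1 hx
  unfold clp; rw [min_eq_left this.2, max_eq_right this.1]

theorem clp_pos {C x : ℝ} (hC : 0 < C) (hx : 0 < x) : 0 < clp C x :=
  lt_max_of_lt_right (lt_min hx hC)

theorem pow5_lip {C x y : ℝ} (hx : |x| ≤ C) (hy : |y| ≤ C) : |x ^ 5 - y ^ 5| ≤ 5 * C ^ 4 * |x - y| := by
  have hC : 0 ≤ C := (abs_nonneg x).trans hx
  have e : x ^ 5 - y ^ 5 = (x ^ 4 + x ^ 3 * y + x ^ 2 * y ^ 2 + x * y ^ 3 + y ^ 4) * (x - y) := by ring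
  rw [e, abs_mul]
  apply mul_le_mul_of_nonneg_right _ (abs_nonneg _)
  have key : ∀ i j : ℕ, i + j = 4 → |x ^ i * y ^ j| ≤ C ^ 4 := by
    intro i j hij
    rw [abs_mul, abs_pow, abs_pow, ← hij, pow_add]
    exact mul_le_mul (pow_le_pow_left₀ (abs_nonneg _) hx i) (pow_le_pow_left₀ (abs_nonneg _) hy j)
      (by positivity) (by positivity)
  have k0 := abs_le.1 (key 4 0 rfl)
  have k1 := abs_le.1 (key 3 1 rfl)
  have k2 := abs_le.1 (key 2 2 rfl)
  have k3 := abs_le.1 (key 1 3 rfl)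
  have k4 := abs_le.1 (key 0 4 rfl)
  simp only [pow_zero, pow_one, mul_one, one_mul] at k0 k1 k2 k3 k4
  rw [abs_le]; constructor <;> linarith [k0.1, k0.2, k1.1, k1.2, k2.1, k2.2, k3.1, k3.2, k4.1, k4.2]

structure CS (C l b : ℝ) (y z : ℝ → ℝ) : Prop where
  cy : ContinuousOn y (Icc 1 2)
  cz : ContinuousOn z (Icc 1 2)
  dy : ∀ r ∈ Ioo (1:ℝ) 2, HasDerivAt y (clp C (z r) / r) r
  dz : ∀ r ∈ Ioo (1:ℝ) 2, HasDerivAt z (r * (l * clp C (y r) - b * clp C (y r) ^ 5)) r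
  y1 : y 1 = 0
  z1 : z 1 = 1

/-- bounds independent of the clamp -/
theorem bounds_aux {L B l b : ℝ} {y z g w : ℝ → ℝ} (hl : |l| ≤ L) (hb : 0 ≤ b) (hbB : b ≤ B)
    (cy : ContinuousOn y (Icc 1 2)) (cz : ContinuousOn z (Icc 1 2))
    (dy : ∀ r ∈ Ioo (1:ℝ) 2, HasDerivAt y (w r / r) r)
    (dz : ∀ r ∈ Ioo (1:ℝ) 2, HasDerivAt z (r * (l * g r - b * g r ^ 5)) r)
    (y1 : y 1 = 0) (z1 : z 1 = 1) (hy : ∀ r ∈ Icc (1:ℝ) 2, 0 ≤ y r)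
    (hg0 : ∀ r ∈ Icc (1:ℝ) 2, 0 ≤ g r) (hg : ∀ r ∈ Icc (1:ℝ) 2, g r ≤ y r)
    (hw : ∀ r ∈ Icc (1:ℝ) 2, w r ≤ max (z r) 0) :
    ∀ r ∈ Icc (1:ℝ) 2, y r ≤ Real.exp (2 * L + 1) ∧
      |z r| ≤ 1 + Real.exp (2 * L + 1) + 2 * (L * Real.exp (2 * L + 1) + B * Real.exp (2 * L + 1) ^ 5) := by
  have hl' := abs_le.1 hl
  have hL : 0 ≤ L := (abs_nonneg l).trans hl
  set E := Real.exp (2 * L + 1) with hE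
  have hE0 : 0 < E := Real.exp_pos _
  obtain ⟨pc, pd⟩ := prim_aux (by norm_num : (1:ℝ) ≤ 2) cy
  set P := fun r => ∫ t in (1:ℝ)..r, y t with hP
  have P1 : P 1 = 0 := by simp [hP]
  have hz : ∀ r ∈ Icc (1:ℝ) 2, z r ≤ 1 + 2 * L * P r := by
    have := anti_aux (f := fun r => z r - 2 * L * P r) (f' := fun r => r * (l * g r - b * g r ^ 5) - 2 * L * y r)
      (cz.sub (continuousOn_const.mul pc)) (fun r hr => (dz r hr).sub ((pd r hr).const_mul _))
      (fun r hr => by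
        have hr' : r ∈ Icc (1:ℝ) 2 := ⟨hr.1.le, hr.2.le⟩
        have h1 : l * g r - b * g r ^ 5 ≤ L * y r := by
          have a1 : l * g r ≤ L * y r := mul_le_mul hl'.2 (hg r hr') (hg0 r hr') hL
          have a2 : 0 ≤ b * g r ^ 5 := mul_nonneg hb (pow_nonneg (hg0 r hr') 5)
          linarith
        have h2 := mul_le_mul_of_nonneg_left h1 (by linarith [hr.1] : 0 ≤ r)
        have h3 := mul_le_mul_of_nonneg_right hr.2.le (mul_nonneg hL (hy r hr'))
        linarith)
    intro r hr
    have := this ⟨le_rfl, by norm_num⟩ hr hr.1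
    simp only [P1, z1] at this
    linarith
  have hP0 : ∀ r ∈ Icc (1:ℝ) 2, 0 ≤ P r := by
    intro r hr
    apply intervalIntegral.integral_nonneg hr.1
    intro t ht
    exact hy t ⟨ht.1, ht.2.trans hr.2⟩
  have hgr : ∀ r ∈ Icc (1:ℝ) 2, 1 + 2 * L * P r + y r ≤ E := by
    have := anti_aux (f := fun r => (1 + 2 * L * P r + y r) * Real.exp (-(2 * L + 1) * r))
      (f' := fun r => (2 * L * y r + w r / r) * Real.exp (-(2 * L + 1) * r) +
        (1 + 2 * L * P r + y r) * (Real.exp (-(2 * L + 1) * r) * (-(2 * L + 1))))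
      (((continuousOn_const.add (continuousOn_const.mul pc)).add cy).mul (by fun_prop))
      (fun r hr => (((((pd r hr).const_mul (2 * L)).const_add 1).add (dy r hr)).mul
        (((hasDerivAt_id r).const_mul (-(2 * L + 1))).exp)).congr_deriv (by simp))
      (fun r hr => by
        have hr' : r ∈ Icc (1:ℝ) 2 := ⟨hr.1.le, hr.2.le⟩
        have hph : 0 ≤ 1 + 2 * L * P r := by have := hP0 r hr'; positivity
        have h1 : w r ≤ 1 + 2 * L * P r := (hw r hr').trans (max_le (hz r hr') hph)
        have h2 : w r / r ≤ 1 + 2 * L * P r := by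
          rw [div_le_iff₀ (by linarith [hr.1])]
          nlinarith [hr.1]
        have h3 := hy r hr'
        have : (2 * L * y r + w r / r) - (1 + 2 * L * P r + y r) * (2 * L + 1) ≤ 0 := by
          nlinarith [mul_nonneg hL hph]
        nlinarith [Real.exp_pos (-(2 * L + 1) * r)])
    intro r hr
    have := this ⟨le_rfl, by norm_num⟩ hr hr.1
    simp only [P1, y1] at this
    have e2 : Real.exp (-(2 * L + 1) * 1) ≤ E * Real.exp (-(2 * L + 1) * r) := by
      rw [hE, ← Real.exp_add]
      apply Real.exp_le_exp.2
      nlinarith [hr.1, hr.2]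
    have e3 := Real.exp_pos (-(2 * L + 1) * r)
    have e4 : (1 + 2 * L * P r + y r) * Real.exp (-(2 * L + 1) * r) ≤ E * Real.exp (-(2 * L + 1) * r) := by
      linarith
    exact le_of_mul_le_mul_right e4 e3
  have hyE : ∀ r ∈ Icc (1:ℝ) 2, y r ≤ E := by
    intro r hr
    have h1 := hgr r hr
    have h2 := hP0 r hr
    nlinarith [mul_nonneg hL h2]
  intro r hr
  refine ⟨hyE r hr, ?_⟩
  have hB : 0 ≤ B := hb.trans hbB
  have hlow := mono_aux (f := fun r => z r + 2 * (L * E + B * E ^ 5) * r)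
    (f' := fun r => r * (l * g r - b * g r ^ 5) + 2 * (L * E + B * E ^ 5)) (a := 1) (b := 2)
    (cz.add (by fun_prop)) (fun r hr => ((dz r hr).add ((hasDerivAt_id r).const_mul _)).congr_deriv (by simp))
    (fun r hr => by
      have hr' : r ∈ Icc (1:ℝ) 2 := ⟨hr.1.le, hr.2.le⟩
      have hgE := (hg r hr').trans (hyE r hr')
      have a1 : -(l * g r) ≤ L * E := by
        rw [← neg_mul]; exact mul_le_mul (by linarith) hgE (hg0 r hr') hL
      have a2 : b * g r ^ 5 ≤ B * E ^ 5 :=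
        mul_le_mul hbB (pow_le_pow_left₀ (hg0 r hr') hgE 5) (pow_nonneg (hg0 r hr') 5) hB
      have a3 : 0 ≤ L * E + B * E ^ 5 := by positivity
      have h2 := mul_le_mul_of_nonneg_left (by linarith : -(L * E + B * E ^ 5) ≤ l * g r - b * g r ^ 5)
        (by linarith [hr.1] : 0 ≤ r)
      nlinarith [hr.2])
  have h1 := hlow ⟨le_rfl, by norm_num⟩ hr hr.1
  simp only [z1] at h1
  have h2 := hz r hr
  have h3 := hgr r hr
  have h4 := hy r hr
  have a3 : 0 ≤ L * E + B * E ^ 5 := by positivity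
  rw [abs_le]
  constructor <;> nlinarith [hr.2]

def C0 (L B : ℝ) : ℝ :=
  1 + Real.exp (2 * L + 1) + 2 * (L * Real.exp (2 * L + 1) + B * Real.exp (2 * L + 1) ^ 5)

theorem C0_pos {L B : ℝ} (hL : 0 ≤ L) (hB : 0 ≤ B) : 0 < C0 L B := by
  unfold C0; positivity

theorem CS.toRS {L B l b : ℝ} {y z : ℝ → ℝ} (hl : |l| ≤ L) (hb : 0 ≤ b) (hbB : b ≤ B)
    (h : CS (C0 L B) l b y z) (hy : ∀ r ∈ Icc (1:ℝ) 2, 0 ≤ y r) : RS l b y z := by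
  have hL : 0 ≤ L := (abs_nonneg l).trans hl
  have hB : 0 ≤ B := hb.trans hbB
  have hC := C0_pos hL hB
  have hbd := bounds_aux hl hb hbB h.cy h.cz h.dy h.dz h.y1 h.z1 hy
    (fun r hr => clp_nonneg hC.le (hy r hr)) (fun r hr => clp_le hC.le (hy r hr))
    (fun r hr => clp_le_max hC.le)
  have hyC : ∀ r ∈ Icc (1:ℝ) 2, |y r| ≤ C0 L B := by
    intro r hr
    rw [abs_of_nonneg (hy r hr)]
    refine (hbd r hr).1.trans ?_
    unfold C0
    have : 0 ≤ 2 * (L * Real.exp (2 * L + 1) + B * Real.exp (2 * L + 1) ^ 5) := by positivity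
    linarith
  refine ⟨h.cy, h.cz, ?_, ?_, h.y1⟩
  · intro r hr
    have := h.dy r hr
    rwa [clp_eq (C := C0 L B) (hbd r ⟨hr.1.le, hr.2.le⟩).2] at this
  · intro r hr
    have := h.dz r hr
    rwa [clp_eq (hyC r ⟨hr.1.le, hr.2.le⟩)] at this

theorem RS.toCS {L B l b : ℝ} {y z : ℝ → ℝ} (hl : |l| ≤ L) (hb : 0 ≤ b) (hbB : b ≤ B)
    (h : RS l b y z) (hz : z 1 = 1) (hy : ∀ r ∈ Icc (1:ℝ) 2, 0 ≤ y r) : CS (C0 L B) l b y z := by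
  have hL : 0 ≤ L := (abs_nonneg l).trans hl
  have hB : 0 ≤ B := hb.trans hbB
  have hC := C0_pos hL hB
  have hbd := bounds_aux hl hb hbB h.cy h.cz h.dy h.dz h.y1 hz hy hy (fun r hr => le_rfl)
    (fun r hr => le_max_left _ _)
  have hyC : ∀ r ∈ Icc (1:ℝ) 2, |y r| ≤ C0 L B := by
    intro r hr
    rw [abs_of_nonneg (hy r hr)]
    refine (hbd r hr).1.trans ?_
    unfold C0
    have : 0 ≤ 2 * (L * Real.exp (2 * L + 1) + B * Real.exp (2 * L + 1) ^ 5) := by positivity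
    linarith
  refine ⟨h.cy, h.cz, ?_, ?_, h.y1, hz⟩
  · intro r hr
    rw [clp_eq (C := C0 L B) (hbd r ⟨hr.1.le, hr.2.le⟩).2]
    exact h.dy r hr
  · intro r hr
    rw [clp_eq (hyC r ⟨hr.1.le, hr.2.le⟩)]
    exact h.dz r hr

set_option maxHeartbeats 1600000 in
/-- continuous dependence -/
theorem CS.dep (C L B : ℝ) (hC : 0 ≤ C) (hL : 0 ≤ L) (hB : 0 ≤ B) : ∃ K : ℝ, 0 ≤ K ∧
    ∀ (l b l' b' : ℝ) (y z y' z' : ℝ → ℝ), |l| ≤ L → |b| ≤ B →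
    CS C l b y z → CS C l' b' y' z' → ∀ r ∈ Icc (1:ℝ) 2,
      |y r - y' r| ≤ K * (|l - l'| + |b - b'|) ∧ |z r - z' r| ≤ K * (|l - l'| + |b - b'|) := by
  set Q := C + C ^ 5 with hQ
  set P := L + 5 * B * C ^ 4 with hP
  set M := 3 + 2 * P with hM
  have hQ0 : 0 ≤ Q := by positivity
  have hP0 : 0 ≤ P := by positivity
  refine ⟨Real.sqrt (2 * Q ^ 2 * Real.exp M), Real.sqrt_nonneg _, ?_⟩
  intro l b l' b' y z y' z' hl hb h h'
  set p := |l - l'| + |b - b'| with hp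
  have hp0 : 0 ≤ p := by positivity
  have hanti := anti_aux (f := fun r => ((y r - y' r) ^ 2 + (z r - z' r) ^ 2 + 2 * Q ^ 2 * p ^ 2) *
      Real.exp (-M * r))
    (f' := fun r => (2 * (y r - y' r) * (clp C (z r) / r - clp C (z' r) / r) +
      2 * (z r - z' r) * (r * (l * clp C (y r) - b * clp C (y r) ^ 5) -
        r * (l' * clp C (y' r) - b' * clp C (y' r) ^ 5))) * Real.exp (-M * r) +
      ((y r - y' r) ^ 2 + (z r - z' r) ^ 2 + 2 * Q ^ 2 * p ^ 2) * (Real.exp (-M * r) * (-M)))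
    (a := 1) (b := 2)
    (((((h.cy.sub h'.cy).pow 2).add ((h.cz.sub h'.cz).pow 2)).add continuousOn_const).mul (by fun_prop))
    (fun r hr => ((((((h.dy r hr).sub (h'.dy r hr)).pow 2).add (((h.dz r hr).sub (h'.dz r hr)).pow 2)).add_const
      (2 * Q ^ 2 * p ^ 2)).mul
        (((hasDerivAt_id r).const_mul (-M)).exp)).congr_deriv (by simp))
    (fun r hr => by
      have hr0 : 0 < r := by linarith [hr.1]
      set d := |y r - y' r| with hd
      set e := |z r - z' r| with he
      have hd0 : 0 ≤ d := abs_nonneg _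
      have he0 : 0 ≤ e := abs_nonneg _
      have hd2 : (y r - y' r) ^ 2 = d ^ 2 := (sq_abs _).symm
      have he2 : (z r - z' r) ^ 2 = e ^ 2 := (sq_abs _).symm
      have t1 : 2 * (y r - y' r) * (clp C (z r) / r - clp C (z' r) / r) ≤ 2 * d * e := by
        refine (le_abs_self _).trans ?_
        rw [abs_mul, abs_mul, abs_two, ← sub_div, abs_div, abs_of_pos hr0]
        apply mul_le_mul_of_nonneg_left _ (by positivity)
        rw [div_le_iff₀ hr0]
        have := clp_lip C (z r) (z' r)
        nlinarith [hr.1]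
      have t2 : |(l * clp C (y r) - b * clp C (y r) ^ 5) - (l' * clp C (y' r) - b' * clp C (y' r) ^ 5)|
          ≤ P * d + Q * p := by
        have a0 : (l * clp C (y r) - b * clp C (y r) ^ 5) - (l' * clp C (y' r) - b' * clp C (y' r) ^ 5) =
          (l * (clp C (y r) - clp C (y' r)) + (l - l') * clp C (y' r)) -
          (b * (clp C (y r) ^ 5 - clp C (y' r) ^ 5) + (b - b') * clp C (y' r) ^ 5) := by ring
        have a1 := clp_lip C (y r) (y' r)
        have a2 := pow5_lip (clp_abs hC (x := y r)) (clp_abs hC (x := y' r))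
        have a3 := clp_abs hC (x := y' r)
        have a4 : |clp C (y' r) ^ 5| ≤ C ^ 5 := by
          rw [abs_pow]; exact pow_le_pow_left₀ (abs_nonneg _) a3 5
        rw [a0]
        have c1 : |l * (clp C (y r) - clp C (y' r))| ≤ L * d := by
          rw [abs_mul]; exact mul_le_mul hl a1 (abs_nonneg _) hL
        have c2 : |(l - l') * clp C (y' r)| ≤ p * C := by
          rw [abs_mul]; exact mul_le_mul (by rw [hp]; linarith [abs_nonneg (b - b')]) a3 (abs_nonneg _) hp0
        have c3 : |b * (clp C (y r) ^ 5 - clp C (y' r) ^ 5)| ≤ B * (5 * C ^ 4 * d) := by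
          rw [abs_mul]
          exact mul_le_mul hb (a2.trans (mul_le_mul_of_nonneg_left a1 (by positivity))) (abs_nonneg _) hB
        have c4 : |(b - b') * clp C (y' r) ^ 5| ≤ p * C ^ 5 := by
          rw [abs_mul]; exact mul_le_mul (by rw [hp]; linarith [abs_nonneg (l - l')]) a4 (abs_nonneg _) hp0
        have d1 := abs_le.1 c1
        have d2 := abs_le.1 c2
        have d3 := abs_le.1 c3
        have d4 := abs_le.1 c4
        have f1 : P * d + Q * p = L * d + p * C + B * (5 * C ^ 4 * d) + p * C ^ 5 := by rw [hP, hQ]; ring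
        rw [f1, abs_le]
        constructor <;> linarith [d1.1, d1.2, d2.1, d2.2, d3.1, d3.2, d4.1, d4.2]
      have t3 : 2 * (z r - z' r) * (r * (l * clp C (y r) - b * clp C (y r) ^ 5) -
        r * (l' * clp C (y' r) - b' * clp C (y' r) ^ 5)) ≤ 2 * e * (2 * (P * d + Q * p)) := by
        refine (le_abs_self _).trans ?_
        rw [abs_mul, abs_mul, abs_two, ← mul_sub, abs_mul, abs_of_pos hr0]
        apply mul_le_mul_of_nonneg_left _ (by positivity)
        exact mul_le_mul hr.2.le t2 (abs_nonneg _) (by norm_num)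
      have t4 : 2 * d * e + 2 * e * (2 * (P * d + Q * p)) ≤ M * (d ^ 2 + e ^ 2 + 2 * Q ^ 2 * p ^ 2) := by
        have s1 : 2 * d * e ≤ d ^ 2 + e ^ 2 := two_mul_le_add_sq d e
        have s2 : P * (2 * d * e) ≤ P * (d ^ 2 + e ^ 2) := mul_le_mul_of_nonneg_left s1 hP0
        have s3 : 2 * e * (Q * p) ≤ e ^ 2 + (Q * p) ^ 2 := two_mul_le_add_sq e (Q * p)
        have s4 : 0 ≤ P * (Q * p) ^ 2 := by positivity
        have s5 : 0 ≤ (Q * p) ^ 2 := by positivity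
        rw [hM]
        nlinarith [sq_nonneg d]
      rw [hd2, he2]
      have := mul_le_mul_of_nonneg_right (by linarith : (2 * (y r - y' r) * (clp C (z r) / r - clp C (z' r) / r) +
        2 * (z r - z' r) * (r * (l * clp C (y r) - b * clp C (y r) ^ 5) -
        r * (l' * clp C (y' r) - b' * clp C (y' r) ^ 5))) ≤ M * (d ^ 2 + e ^ 2 + 2 * Q ^ 2 * p ^ 2))
        (Real.exp_pos (-M * r)).le
      linarith)
  intro r hr
  have := hanti ⟨le_rfl, by norm_num⟩ hr hr.1
  simp only [h.y1, h'.y1, h.z1, h'.z1, sub_self] at this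
  have e2 : Real.exp (-M * 1) ≤ Real.exp M * Real.exp (-M * r) := by
    rw [← Real.exp_add]
    apply Real.exp_le_exp.2
    have : 0 ≤ M := by positivity
    nlinarith [hr.1, hr.2]
  have e3 := Real.exp_pos (-M * r)
  have e4 : ((y r - y' r) ^ 2 + (z r - z' r) ^ 2 + 2 * Q ^ 2 * p ^ 2) * Real.exp (-M * r) ≤
      (2 * Q ^ 2 * p ^ 2 * Real.exp M) * Real.exp (-M * r) := by
    have : 0 ≤ 2 * Q ^ 2 * p ^ 2 := by positivity
    nlinarith
  have e5 := le_of_mul_le_mul_right e4 e3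
  have e6 : 0 ≤ 2 * Q ^ 2 * p ^ 2 := by positivity
  have e7 : (Real.sqrt (2 * Q ^ 2 * Real.exp M) * p) ^ 2 = 2 * Q ^ 2 * p ^ 2 * Real.exp M := by
    rw [mul_pow, Real.sq_sqrt (by positivity)]; ring
  constructor
  · apply abs_le_of_sq_le_sq _ (by positivity)
    rw [e7]; nlinarith [sq_nonneg (z r - z' r)]
  · apply abs_le_of_sq_le_sq _ (by positivity)
    rw [e7]; nlinarith [sq_nonneg (y r - y' r)]

theorem CS.ex (C l b : ℝ) (hC : 0 ≤ C) : ∃ w : (ℝ → ℝ) × (ℝ → ℝ), CS C l b w.1 w.2 := by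
  let f : ℝ → ℝ × ℝ → ℝ × ℝ := fun t x => (clp C x.2 / t, t * (l * clp C x.1 - b * clp C x.1 ^ 5))
  let K : NNReal := ⟨1 + 2 * (|l| + |b| * (5 * C ^ 4)), by positivity⟩
  let M : NNReal := ⟨C + 2 * (|l| * C + |b| * C ^ 5), by positivity⟩
  have hpl : IsPicardLindelof f (tmin := 1) (tmax := 2) ⟨1, by norm_num⟩ ((0:ℝ), (1:ℝ)) M 0 M K := by
    refine ⟨?_, ?_, ?_, ?_⟩
    · intro t ht
      apply LipschitzOnWith.of_dist_le_mul
      intro x _ x' _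
      have ht0 : 0 < t := by linarith [ht.1]
      have hx1 : |x.1 - x'.1| ≤ dist x x' := by
        rw [Prod.dist_eq]; exact le_max_left _ _
      have hx2 : |x.2 - x'.2| ≤ dist x x' := by
        rw [Prod.dist_eq]; exact le_max_right _ _
      have hd : 0 ≤ dist x x' := dist_nonneg
      set D := dist x x'
      change dist (f t x) (f t x') ≤ (1 + 2 * (|l| + |b| * (5 * C ^ 4))) * D
      rw [Prod.dist_eq]
      apply max_le
      · change |clp C x.2 / t - clp C x'.2 / t| ≤ _
        rw [← sub_div, abs_div, abs_of_pos ht0, div_le_iff₀ ht0]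
        have h1 := (clp_lip C x.2 x'.2).trans hx2
        have h2 : 0 ≤ (2 * (|l| + |b| * (5 * C ^ 4))) * D := by positivity
        nlinarith [ht.1]
      · change |t * (l * clp C x.1 - b * clp C x.1 ^ 5) - t * (l * clp C x'.1 - b * clp C x'.1 ^ 5)| ≤ _
        rw [← mul_sub, abs_mul, abs_of_pos ht0]
        have h1 := (clp_lip C x.1 x'.1).trans hx1
        have h2 := (pow5_lip (clp_abs hC (x := x.1)) (clp_abs hC (x := x'.1))).trans
          (mul_le_mul_of_nonneg_left h1 (by positivity))
        have h3 : |l * clp C x.1 - b * clp C x.1 ^ 5 - (l * clp C x'.1 - b * clp C x'.1 ^ 5)| ≤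
            (|l| + |b| * (5 * C ^ 4)) * D := by
          have e : l * clp C x.1 - b * clp C x.1 ^ 5 - (l * clp C x'.1 - b * clp C x'.1 ^ 5) =
            l * (clp C x.1 - clp C x'.1) - b * (clp C x.1 ^ 5 - clp C x'.1 ^ 5) := by ring
          rw [e]
          refine (abs_sub _ _).trans ?_
          rw [abs_mul, abs_mul]
          have := mul_le_mul_of_nonneg_left h1 (abs_nonneg l)
          have := mul_le_mul_of_nonneg_left h2 (abs_nonneg b)
          nlinarith
        have h4 := mul_le_mul ht.2 h3 (abs_nonneg _) (by norm_num)
        linarith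
    · intro x _
      apply ContinuousOn.prodMk
      · exact continuousOn_const.div continuousOn_id (fun t ht => by
          have : (1:ℝ) ≤ t := ht.1
          simp; linarith)
      · fun_prop
    · intro t ht x _
      have ht0 : 0 < t := by linarith [ht.1]
      change ‖f t x‖ ≤ C + 2 * (|l| * C + |b| * C ^ 5)
      have h0 : 0 ≤ |l| * C + |b| * C ^ 5 := by positivity
      rw [Prod.norm_def]
      apply max_le
      · change |clp C x.2 / t| ≤ _
        rw [abs_div, abs_of_pos ht0, div_le_iff₀ ht0]
        have := clp_abs hC (x := x.2)
        nlinarith [ht.1]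
      · change |t * (l * clp C x.1 - b * clp C x.1 ^ 5)| ≤ _
        rw [abs_mul, abs_of_pos ht0]
        have h3 : |l * clp C x.1 - b * clp C x.1 ^ 5| ≤ |l| * C + |b| * C ^ 5 := by
          refine (abs_sub _ _).trans ?_
          rw [abs_mul, abs_mul, abs_pow]
          have := clp_abs hC (x := x.1)
          have := pow_le_pow_left₀ (abs_nonneg _) this 5
          gcongr
        have := mul_le_mul ht.2 h3 (abs_nonneg _) (by norm_num)
        linarith
    · change (C + 2 * (|l| * C + |b| * C ^ 5)) * max (2 - 1) (1 - 1) ≤ (C + 2 * (|l| * C + |b| * C ^ 5)) - 0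
      norm_num
  obtain ⟨α, h0, h1⟩ := hpl.exists_eq_forall_mem_Icc_hasDerivWithinAt₀
  have h0 : α 1 = (0, 1) := h0
  have hc : ContinuousOn α (Icc 1 2) := fun t ht => (h1 t ht).continuousWithinAt
  have hd : ∀ t ∈ Ioo (1:ℝ) 2, HasDerivAt α (f t (α t)) t := fun t ht =>
    (h1 t ⟨ht.1.le, ht.2.le⟩).hasDerivAt (Icc_mem_nhds ht.1 ht.2)
  refine ⟨(fun t => (α t).1, fun t => (α t).2), hc.fst, hc.snd, ?_, ?_, by simp [h0], by simp [h0]⟩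
  · intro r hr
    have := (hasFDerivAt_fst (𝕜 := ℝ) (p := α r)).comp_hasDerivAt r (hd r hr)
    exact this
  · intro r hr
    have := (hasFDerivAt_snd (𝕜 := ℝ) (p := α r)).comp_hasDerivAt r (hd r hr)
    exact this

/-- the family of clamped solutions -/
def FW (L B : ℝ) (p : ℝ × ℝ) : (ℝ → ℝ) × (ℝ → ℝ) :=
  Classical.epsilon (fun w : (ℝ → ℝ) × (ℝ → ℝ) => CS (C0 L B) p.1 p.2 w.1 w.2)

def FY (L B : ℝ) (p : ℝ × ℝ) : ℝ → ℝ := (FW L B p).1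
def FZ (L B : ℝ) (p : ℝ × ℝ) : ℝ → ℝ := (FW L B p).2

def bx (L B : ℝ) : Set (ℝ × ℝ) := Icc (-L) L ×ˢ Icc 0 B

theorem fam_CS {L B : ℝ} (hL : 0 ≤ L) (hB : 0 ≤ B) (p : ℝ × ℝ) :
    CS (C0 L B) p.1 p.2 (FY L B p) (FZ L B p) :=
  Classical.epsilon_spec (p := fun w : (ℝ → ℝ) × (ℝ → ℝ) => CS (C0 L B) p.1 p.2 w.1 w.2)
    (CS.ex (C0 L B) p.1 p.2 (C0_pos hL hB).le)

theorem fam_lip {L B : ℝ} (hL : 0 ≤ L) (hB : 0 ≤ B) : ∃ K : ℝ, 0 ≤ K ∧ ∀ p ∈ bx L B, ∀ q ∈ bx L B,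
    ∀ r ∈ Icc (1:ℝ) 2, |FY L B p r - FY L B q r| ≤ K * dist p q := by
  obtain ⟨K, hK, h⟩ := CS.dep (C0 L B) L B (C0_pos hL hB).le hL hB
  refine ⟨2 * K, by positivity, ?_⟩
  intro p hp q hq r hr
  have := (h p.1 p.2 q.1 q.2 _ _ _ _ (abs_le.2 hp.1) (abs_le.2 ⟨by linarith [hp.2.1], hp.2.2⟩)
    (fam_CS hL hB p) (fam_CS hL hB q) r hr).1
  refine this.trans ?_
  have h1 : |p.1 - q.1| ≤ dist p q := by rw [Prod.dist_eq]; exact le_max_left _ _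
  have h2 : |p.2 - q.2| ≤ dist p q := by rw [Prod.dist_eq]; exact le_max_right _ _
  nlinarith

theorem fam_cont {L B : ℝ} (hL : 0 ≤ L) (hB : 0 ≤ B) {r : ℝ} (hr : r ∈ Icc (1:ℝ) 2) :
    ContinuousOn (fun p => FY L B p r) (bx L B) := by
  obtain ⟨K, hK, h⟩ := fam_lip hL hB
  have : LipschitzOnWith ⟨K, hK⟩ (fun p => FY L B p r) (bx L B) := by
    apply LipschitzOnWith.of_dist_le_mul
    intro p hp q hq
    exact h p hp q hq r hr
  exact this.continuousOn

theorem fam_bound {L B : ℝ} (hL : 0 ≤ L) (hB : 0 ≤ B) (p : ℝ × ℝ) :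
    ∀ r ∈ Icc (1:ℝ) 2, |FY L B p r| ≤ C0 L B := by
  have h := fam_CS hL hB p
  have hC := C0_pos hL hB
  intro r hr
  have hcl : ∀ r ∈ Ioo (1:ℝ) 2, |clp (C0 L B) (FZ L B p r) / r| ≤ C0 L B := by
    intro r hr
    have hr0 : 0 < r := by linarith [hr.1]
    rw [abs_div, abs_of_pos hr0, div_le_iff₀ hr0]
    have := clp_abs hC.le (x := FZ L B p r)
    nlinarith [hr.1]
  have h1 := mono_aux (f := fun r => FY L B p r + C0 L B * r)
    (f' := fun r => clp (C0 L B) (FZ L B p r) / r + C0 L B) (h.cy.add (by fun_prop))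
    (fun r hr => ((h.dy r hr).add ((hasDerivAt_id r).const_mul _)).congr_deriv (by simp))
    (fun r hr => by linarith [(abs_le.1 (hcl r hr)).1]) ⟨le_rfl, by norm_num⟩ hr hr.1
  have h2 := anti_aux (f := fun r => FY L B p r - C0 L B * r)
    (f' := fun r => clp (C0 L B) (FZ L B p r) / r - C0 L B) (h.cy.sub (by fun_prop))
    (fun r hr => ((h.dy r hr).sub ((hasDerivAt_id r).const_mul _)).congr_deriv (by simp))
    (fun r hr => by linarith [(abs_le.1 (hcl r hr)).2]) ⟨le_rfl, by norm_num⟩ hr hr.1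
  simp only [h.y1] at h1 h2
  rw [abs_le]
  constructor <;> nlinarith [hr.2]

theorem fam_near {L B : ℝ} (hL : 0 ≤ L) (hB : 0 ≤ B) : ∃ δ > 0, δ < 1 ∧ ∀ p ∈ bx L B,
    ∀ r ∈ Ioc (1:ℝ) (1 + δ), 0 < FY L B p r := by
  have hC := C0_pos hL hB
  set C := C0 L B
  set G := 2 * (L * C + B * C ^ 5) with hG
  have hG0 : 0 ≤ G := by positivity
  refine ⟨1 / (2 * G + 2), by positivity, ?_, ?_⟩
  · rw [div_lt_one (by positivity)]; linarith
  intro p hp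
  have h := fam_CS hL hB p
  set δ := 1 / (2 * G + 2) with hδ
  have hδ0 : 0 < δ := by positivity
  have hδG : G * δ ≤ 1 / 2 := by rw [hδ]; rw [mul_one_div, div_le_iff₀ (by positivity)]; linarith
  have hδ1 : δ ≤ 1 / 2 := by rw [hδ]; rw [div_le_iff₀ (by positivity)]; linarith
  have hz := mono_aux (f := fun r => FZ L B p r + G * r)
    (f' := fun r => r * (p.1 * clp C (FY L B p r) - p.2 * clp C (FY L B p r) ^ 5) + G)
    (a := 1) (b := 2) (h.cz.add (by fun_prop))
    (fun r hr => ((h.dz r hr).add ((hasDerivAt_id r).const_mul _)).congr_deriv (by simp; left; rfl))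
    (fun r hr => by
      have h1 : |p.1 * clp C (FY L B p r) - p.2 * clp C (FY L B p r) ^ 5| ≤ L * C + B * C ^ 5 := by
        refine (abs_sub _ _).trans ?_
        rw [abs_mul, abs_mul, abs_pow]
        have a1 := clp_abs hC.le (x := FY L B p r)
        have a2 : |p.1| ≤ L := abs_le.2 hp.1
        have a3 : |p.2| ≤ B := abs_le.2 ⟨by linarith [hp.2.1], hp.2.2⟩
        gcongr
      have h2 := (abs_le.1 h1).1
      have h0 : 0 ≤ L * C + B * C ^ 5 := by positivity
      have := mul_le_mul_of_nonneg_left h2 (by linarith [hr.1] : 0 ≤ r)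
      nlinarith [hr.2])
  have hzp : ∀ r ∈ Icc (1:ℝ) (1 + δ), 0 < FZ L B p r := by
    intro r hr
    have := hz ⟨le_rfl, by norm_num⟩ (⟨hr.1, by linarith [hr.2]⟩ : r ∈ Icc (1:ℝ) 2) hr.1
    simp only [h.z1] at this
    nlinarith [hr.2]
  have hsm := smono_aux (a := 1) (b := 1 + δ) (h.cy.mono (Icc_subset_Icc_right (by linarith)))
    (fun r hr => h.dy r ⟨hr.1, by linarith [hr.2]⟩)
    (fun r hr => by
      have := clp_pos hC (hzp r ⟨hr.1.le, hr.2.le⟩)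
      have : 0 < r := by linarith [hr.1]
      positivity)
  intro r hr
  have := hsm ⟨le_rfl, by linarith⟩ ⟨hr.1.le, hr.2⟩ hr.1
  rwa [h.y1] at this

theorem fam_RS {L B : ℝ} (hL : 0 ≤ L) (hB : 0 ≤ B) {p : ℝ × ℝ} (hp : p ∈ bx L B)
    (h0 : ∀ r ∈ Icc (1:ℝ) 2, 0 ≤ FY L B p r) : RS p.1 p.2 (FY L B p) (FZ L B p) :=
  CS.toRS (abs_le.2 hp.1) hp.2.1 hp.2.2 (fam_CS hL hB p) h0

theorem fam_eq {L B l b : ℝ} (hL : 0 ≤ L) (hB : 0 ≤ B) (hp : (l, b) ∈ bx L B) {y z : ℝ → ℝ}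
    (h : RS l b y z) (hz : z 1 = 1) (h0 : ∀ r ∈ Icc (1:ℝ) 2, 0 ≤ y r) :
    ∀ r ∈ Icc (1:ℝ) 2, FY L B (l, b) r = y r := by
  obtain ⟨K, hK, hd⟩ := CS.dep (C0 L B) L B (C0_pos hL hB).le hL hB
  intro r hr
  have := (hd l b l b _ _ _ _ (abs_le.2 hp.1) (abs_le.2 ⟨by linarith [hp.2.1], hp.2.2⟩)
    (fam_CS hL hB (l, b)) (h.toCS (abs_le.2 hp.1) hp.2.1 hp.2.2 hz h0) r hr).1
  simp at this
  linarith

theorem exit_lemma {L B : ℝ} (hL : 0 ≤ L) (hB : 0 ≤ B) (γ : ℝ → ℝ × ℝ) (hγ : ContinuousOn γ (Icc 0 1))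
    (hm : ∀ t ∈ Icc (0:ℝ) 1, γ t ∈ bx L B) (hs : ∀ r ∈ Icc (1:ℝ) 2, 0 ≤ FY L B (γ 0) r)
    (he : ¬ ∀ r ∈ Icc (1:ℝ) 2, 0 ≤ FY L B (γ 1) r) :
    ∃ t ∈ Icc (0:ℝ) 1, (∀ r ∈ Icc (1:ℝ) 2, 0 ≤ FY L B (γ t) r) ∧ FY L B (γ t) 2 = 0 := by
  set S := {t ∈ Icc (0:ℝ) 1 | ∀ r ∈ Icc (1:ℝ) 2, 0 ≤ FY L B (γ t) r} with hS
  have hSc : IsClosed S := by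
    have : S = ⋂ r : Icc (1:ℝ) 2, {t ∈ Icc (0:ℝ) 1 | 0 ≤ FY L B (γ t) r} := by
      ext t
      simp only [hS, mem_ofPred_eq, mem_iInter]
      constructor
      · intro h r; exact ⟨h.1, h.2 r r.2⟩
      · intro h; exact ⟨(h ⟨1, by norm_num⟩).1, fun r hr => (h ⟨r, hr⟩).2⟩
    rw [this]
    apply isClosed_iInter
    intro r
    have hc : ContinuousOn (fun t => FY L B (γ t) r) (Icc 0 1) := (fam_cont hL hB r.2).comp hγ hm
    exact hc.preimage_isClosed_of_isClosed isClosed_Icc isClosed_Ici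
  have hne : S.Nonempty := ⟨0, ⟨by norm_num, hs⟩⟩
  have hbd : BddAbove S := ⟨1, fun t ht => ht.1.2⟩
  have hτ := hSc.csSup_mem hne hbd
  set τ := sSup S with hτd
  refine ⟨τ, hτ.1, hτ.2, ?_⟩
  by_contra hn
  have hpos2 : 0 < FY L B (γ τ) 2 := lt_of_le_of_ne (hτ.2 2 (by norm_num)) (Ne.symm hn)
  have hτ1 : τ < 1 := lt_of_le_of_ne hτ.1.2 (fun h => he (by have h2 := hτ.2; rwa [h] at h2))
  have hRS := fam_RS hL hB (hm τ hτ.1) hτ.2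
  have hpos := hRS.pos_of_nonneg (by rw [(fam_CS hL hB (γ τ)).z1]; norm_num) hτ.2
  obtain ⟨δ, hδ, hδ1, hnear⟩ := fam_near hL hB
  obtain ⟨K, hK, hlip⟩ := fam_lip hL hB
  obtain ⟨r0, hr0, hmin⟩ := isCompact_Icc.exists_isMinOn (s := Icc (1 + δ) (2:ℝ)) ⟨2, by constructor <;> linarith⟩
    (hRS.cy.mono (Icc_subset_Icc_left (by linarith)))
  have hε : 0 < FY L B (γ τ) r0 := by
    rcases hr0.2.eq_or_lt with h | h
    · rw [h]; exact hpos2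
    · exact hpos r0 ⟨by linarith [hr0.1], h⟩
  set ε := FY L B (γ τ) r0 with hεd
  have hev : ∀ᶠ t in 𝓝[Icc 0 1] τ, K * dist (γ t) (γ τ) < ε := by
    have h1 : Tendsto (fun t => K * dist (γ t) (γ τ)) (𝓝[Icc 0 1] τ) (𝓝 (K * dist (γ τ) (γ τ))) :=
      ((hγ τ hτ.1).dist continuousWithinAt_const).const_smul K
    rw [dist_self, mul_zero] at h1
    exact h1.eventually (gt_mem_nhds hε)
  have hev2 : ∀ᶠ t in 𝓝[>] τ, K * dist (γ t) (γ τ) < ε := by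
    apply hev.filter_mono
    rw [nhdsWithin_le_iff]
    filter_upwards [Ioo_mem_nhdsGT hτ1] with t ht
    exact ⟨by linarith [ht.1, hτ.1.1], ht.2.le⟩
  obtain ⟨t, ht1, ht2⟩ := (hev2.and (Ioo_mem_nhdsGT hτ1)).exists
  have htm : t ∈ Icc (0:ℝ) 1 := ⟨by linarith [ht2.1, hτ.1.1], ht2.2.le⟩
  have : t ∈ S := by
    refine ⟨htm, ?_⟩
    intro r hr
    rcases hr.1.eq_or_lt with h | h
    · rw [← h, (fam_CS hL hB (γ t)).y1]
    rcases le_or_gt r (1 + δ) with h' | h'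
    · exact (hnear _ (hm t htm) r ⟨h, h'⟩).le
    · have a1 := hlip _ (hm t htm) _ (hm τ hτ.1) r hr
      have a2 : ε ≤ FY L B (γ τ) r := hmin ⟨h'.le, hr.2⟩
      linarith [(abs_le.1 a1).1]
  have := le_csSup hbd this
  linarith [ht2.1]

/-- The zero set -/
def Sg (L B : ℝ) : Set (ℝ × ℝ) :=
  {p ∈ bx L B | (∀ r ∈ Icc (1:ℝ) 2, 0 ≤ FY L B p r) ∧ FY L B p 2 = 0}

theorem Sg_closed {L B : ℝ} (hL : 0 ≤ L) (hB : 0 ≤ B) : IsClosed (Sg L B) := by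
  have hbx : IsClosed (bx L B) := isClosed_Icc.prod isClosed_Icc
  have : Sg L B = (⋂ r : Icc (1:ℝ) 2, {p ∈ bx L B | FY L B p r ∈ Ici (0:ℝ)}) ∩
      {p ∈ bx L B | FY L B p 2 ∈ ({0} : Set ℝ)} := by
    ext p
    simp only [Sg, mem_ofPred_eq, mem_iInter, mem_inter_iff, mem_Ici, mem_singleton_iff]
    constructor
    · intro h; exact ⟨fun r => ⟨h.1, h.2.1 r r.2⟩, h.1, h.2.2⟩
    · intro h; exact ⟨h.2.1, fun r hr => (h.1 ⟨r, hr⟩).2, h.2.2⟩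
  rw [this]
  apply IsClosed.inter
  · apply isClosed_iInter
    intro r
    exact (fam_cont hL hB r.2).preimage_isClosed_of_isClosed hbx isClosed_Ici
  · exact (fam_cont hL hB (by norm_num)).preimage_isClosed_of_isClosed hbx isClosed_singleton

theorem Sg_compact {L B : ℝ} (hL : 0 ≤ L) (hB : 0 ≤ B) : IsCompact (Sg L B) :=
  (isCompact_Icc.prod isCompact_Icc).of_isClosed_subset (Sg_closed hL hB) (fun _ hp => hp.1)

def mp (L B : ℝ) (p : ℝ × ℝ) : ℝ := Real.sqrt p.2 * ∫ r in (1:ℝ)..2, FY L B p r ^ 2 * r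

theorem mp_cont {L B : ℝ} (hL : 0 ≤ L) (hB : 0 ≤ B) : ContinuousOn (mp L B) (bx L B) := by
  obtain ⟨K, hK, hlip⟩ := fam_lip hL hB
  have hC := C0_pos hL hB
  apply ContinuousOn.mul (by fun_prop)
  have hInteg : ∀ p, IntervalIntegrable (fun r => FY L B p r ^ 2 * r) volume 1 2 := by
    intro p
    apply ContinuousOn.intervalIntegrable
    rw [uIcc_of_le (by norm_num)]
    exact ((fam_CS hL hB p).cy.pow 2).mul continuousOn_id
  have : LipschitzOnWith ⟨4 * C0 L B * K, by positivity⟩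
      (fun p => ∫ r in (1:ℝ)..2, FY L B p r ^ 2 * r) (bx L B) := by
    apply LipschitzOnWith.of_dist_le_mul
    intro p hp q hq
    change |(∫ r in (1:ℝ)..2, FY L B p r ^ 2 * r) - (∫ r in (1:ℝ)..2, FY L B q r ^ 2 * r)| ≤
      4 * C0 L B * K * dist p q
    rw [← intervalIntegral.integral_sub (hInteg p) (hInteg q)]
    have := intervalIntegral.norm_integral_le_of_norm_le_const (a := 1) (b := 2)
      (f := fun r => FY L B p r ^ 2 * r - FY L B q r ^ 2 * r) (C := 4 * C0 L B * K * dist p q) (by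
        intro r hr
        rw [uIoc_of_le (by norm_num)] at hr
        have hr' : r ∈ Icc (1:ℝ) 2 := ⟨hr.1.le, hr.2⟩
        have e : FY L B p r ^ 2 * r - FY L B q r ^ 2 * r =
          (FY L B p r - FY L B q r) * (FY L B p r + FY L B q r) * r := by ring
        have a1 := hlip p hp q hq r hr'
        have a2 : |FY L B p r + FY L B q r| ≤ 2 * C0 L B := by
          refine (abs_add_le _ _).trans ?_
          linarith [fam_bound hL hB p r hr', fam_bound hL hB q r hr']
        have a3 : |r| ≤ 2 := by rw [abs_of_pos (by linarith [hr.1])]; exact hr.2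
        rw [e, Real.norm_eq_abs, abs_mul, abs_mul]
        calc _ ≤ (K * dist p q) * (2 * C0 L B) * 2 := by gcongr
          _ = _ := by ring)
    rw [Real.norm_eq_abs] at this
    norm_num at this
    exact this
  exact this.continuousOn

theorem mp_ivt {L B a l0 b0 bs c : ℝ} (hL : 0 ≤ L) (hB : 0 ≤ B)
    (hs : (a, bs) ∈ Sg L B) (ha : mp L B (a, bs) ≤ c) (h0 : (l0, b0) ∈ Sg L B) (hal : a ≤ l0)
    (hm : c ≤ mp L B (l0, b0))
    (hex : ∀ l ∈ Icc a l0, ∃ b, (l, b) ∈ Sg L B) :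
    ∃ l ∈ Icc a l0, ∃ b, (l, b) ∈ Sg L B ∧ mp L B (l, b) = c := by
  have hsub : Sg L B ⊆ bx L B := fun _ hp => hp.1
  have hmc := (mp_cont hL hB).mono hsub
  set U := {p ∈ Sg L B | mp L B p ∈ Iic c}
  set V := {p ∈ Sg L B | mp L B p ∈ Ici c}
  have hU : IsClosed (Prod.fst '' U) :=
    (((Sg_compact hL hB).of_isClosed_subset
      (hmc.preimage_isClosed_of_isClosed (Sg_closed hL hB) isClosed_Iic) (fun _ hp => hp.1)).image
      continuous_fst).isClosed
  have hV : IsClosed (Prod.fst '' V) :=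
    (((Sg_compact hL hB).of_isClosed_subset
      (hmc.preimage_isClosed_of_isClosed (Sg_closed hL hB) isClosed_Ici) (fun _ hp => hp.1)).image
      continuous_fst).isClosed
  obtain ⟨l, hl, ⟨p, hp, hpl⟩, ⟨q, hq, hql⟩⟩ := isPreconnected_closed_iff.1 (isPreconnected_Icc (a := a) (b := l0))
    _ _ hU hV (by
      intro l hl
      obtain ⟨b, hb⟩ := hex l hl
      rcases le_total (mp L B (l, b)) c with h | h
      · exact Or.inl ⟨(l, b), ⟨hb, h⟩, rfl⟩
      · exact Or.inr ⟨(l, b), ⟨hb, h⟩, rfl⟩)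
    ⟨a, ⟨le_rfl, hal⟩, (a, bs), ⟨hs, ha⟩, rfl⟩ ⟨l0, ⟨hal, le_rfl⟩, (l0, b0), ⟨h0, hm⟩, rfl⟩
  obtain ⟨l1, b⟩ := p
  obtain ⟨l2, b'⟩ := q
  simp only at hpl hql
  subst hpl
  subst hql
  have hp1 := hp.1
  have hq1 := hq.1
  have r1 := fam_RS hL hB hp1.1 hp1.2.1
  have r2 := fam_RS hL hB hq1.1 hq1.2.1
  have z1 := (fam_CS hL hB (l2, b)).z1
  have z2 := (fam_CS hL hB (l2, b')).z1
  have : b = b' := RS.unique r1 r2 hp1.1.2.1 hq1.1.2.1 z1 z2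
    (r1.pos_of_nonneg (by rw [z1]; norm_num) hp1.2.1) (r2.pos_of_nonneg (by rw [z2]; norm_num) hq1.2.1)
    hp1.2.2 hq1.2.2
  subst this
  exact ⟨l2, hl, b, hp1, le_antisymm hp.2 hq.2⟩

theorem RS_log : RS 0 0 Real.log (fun _ => 1) where
  cy := Real.continuousOn_log.mono (fun r hr => by
    have : (1:ℝ) ≤ r := hr.1
    simp; linarith)
  cz := continuousOn_const
  dy := fun r hr => by
    have := Real.hasDerivAt_log (by linarith [hr.1] : r ≠ 0)
    rwa [← one_div] at this
  dz := fun r hr => by simpa using hasDerivAt_const r (1:ℝ)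
  y1 := Real.log_one

theorem fam_zero {L B : ℝ} (hL : 0 ≤ L) (hB : 0 ≤ B) :
    ∀ r ∈ Icc (1:ℝ) 2, FY L B (0, 0) r = Real.log r :=
  fam_eq hL hB ⟨⟨by simp; exact hL, hL⟩, ⟨le_rfl, hB⟩⟩ RS_log rfl (fun r hr => Real.log_nonneg hr.1)

theorem exists_lstar : ∃ (l : ℝ) (y z : ℝ → ℝ), l < 0 ∧ RS l 0 y z ∧ z 1 = 1 ∧
    (∀ r ∈ Ioo (1:ℝ) 2, 0 < y r) ∧ y 2 = 0 := by
  set L := (Real.pi / Real.log 2) ^ 2 + 1 with hLd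
  have hL : 0 < L := by positivity
  have hm : ∀ t ∈ Icc (0:ℝ) 1, ((-(t * L), 0) : ℝ × ℝ) ∈ bx L 0 := by
    intro t ht
    refine ⟨⟨?_, ?_⟩, le_rfl, le_rfl⟩
    · simp only; nlinarith [ht.2]
    · simp only; nlinarith [ht.1]
  obtain ⟨t, ht, h0, h2⟩ := exit_lemma hL.le le_rfl (fun t => (-(t * L), 0)) (by fun_prop) hm
    (by
      intro r hr
      simp only [zero_mul, neg_zero]
      rw [fam_zero hL.le le_rfl r hr]
      exact Real.log_nonneg hr.1)
    (by
      intro h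
      have hR := fam_RS hL.le le_rfl (hm 1 (by norm_num)) h
      exact hR.not_nonneg le_rfl (fam_CS hL.le le_rfl _).z1 (by simp [hLd]) h)
  have hR := fam_RS hL.le le_rfl (hm t ht) h0
  have hz := (fam_CS hL.le le_rfl (-(t * L), 0)).z1
  refine ⟨-(t * L), _, _, ?_, hR, hz, hR.pos_of_nonneg (by rw [hz]; norm_num) h0, h2⟩
  have ht0 : t ≠ 0 := by
    rintro rfl
    simp only [zero_mul, neg_zero] at h2
    rw [fam_zero hL.le le_rfl 2 (by norm_num)] at h2
    have := Real.log_pos (by norm_num : (1:ℝ) < 2)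
    linarith
  have : 0 < t := lt_of_le_of_ne ht.1 (Ne.symm ht0)
  have : 0 < t * L := by positivity
  linarith

theorem exists_beta {a L B : ℝ} {Y Z : ℝ → ℝ} (ha : a < 0) (H : RS a 0 Y Z)
    (hY : ∀ r ∈ Ioo (1:ℝ) 2, 0 < Y r) (hY2 : Y 2 = 0) (hL : 0 ≤ L) (hB : 0 ≤ B)
    (hap : ∀ (l b : ℝ) (y z : ℝ → ℝ), |l| ≤ L → 0 ≤ b → RS l b y z →
    (∀ r ∈ Icc (1:ℝ) 2, 0 ≤ y r) → z 1 = 1 → b < B) {l : ℝ} (hl : a < l) (hlL : |l| ≤ L) :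
    ∃ b, (l, b) ∈ Sg L B := by
  have hl' := abs_le.1 hlL
  have hm0 : ∀ t ∈ Icc (0:ℝ) 1, ((t * l, 0) : ℝ × ℝ) ∈ bx L B := by
    intro t ht
    refine ⟨⟨?_, ?_⟩, le_rfl, hB⟩
    · simp only; nlinarith [ht.2, ht.1]
    · simp only; nlinarith [ht.1, ht.2]
  have hstart : ∀ r ∈ Icc (1:ℝ) 2, 0 ≤ FY L B (l, 0) r := by
    by_contra hn
    obtain ⟨t, ht, h0, h2⟩ := exit_lemma hL hB (fun t => (t * l, 0)) (by fun_prop) hm0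
      (by
        intro r hr
        simp only [zero_mul]
        rw [fam_zero hL hB r hr]
        exact Real.log_nonneg hr.1)
      (by simpa using hn)
    have hR := fam_RS hL hB (hm0 t ht) h0
    have hz := (fam_CS hL hB (t * l, 0)).z1
    have := hR.pos_gt H hz hY hY2.ge (by
      simp only
      rcases ht.1.eq_or_lt with h | h
      · rw [← h]; simpa using ha
      · nlinarith [ht.2]) 2 (by norm_num)
    linarith
  have hm : ∀ t ∈ Icc (0:ℝ) 1, ((l, t * B) : ℝ × ℝ) ∈ bx L B := by
    intro t ht
    refine ⟨hl', ?_, ?_⟩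
    · simp only; nlinarith [ht.1]
    · simp only; nlinarith [ht.1, ht.2]
  obtain ⟨t, ht, h0, h2⟩ := exit_lemma hL hB (fun t => (l, t * B)) (by fun_prop) hm
    (by simpa using hstart)
    (by
      intro h
      have hR := fam_RS hL hB (hm 1 (by norm_num)) h
      have := hap _ _ _ _ hlL (by simpa using hB) hR h (fam_CS hL hB _).z1
      simp at this)
  exact ⟨t * B, hm t ht, h0, h2⟩

/-- Picone inequality -/
theorem picone {l : ℝ} {y z φ g : ℝ → ℝ} (h : RS l 0 y z) (hz : z 1 = 1)
    (hy : ∀ r ∈ Ioo (1:ℝ) 2, 0 < y r) (hy2 : y 2 = 0)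
    (hg : ContinuousOn g (Icc 1 2)) (hd : ∀ r ∈ Icc (1:ℝ) 2, HasDerivWithinAt φ (g r) (Icc 1 2) r)
    (h1 : φ 1 = 0) (h2 : φ 2 = 0) :
    0 ≤ ∫ r in (1:ℝ)..2, (r * g r ^ 2 + l * (r * φ r ^ 2)) := by
  have hφ : ContinuousOn φ (Icc 1 2) := fun r hr => (hd r hr).continuousWithinAt
  have hz2 : z 2 ≠ 0 := by
    intro h0
    have := h.doubleZero (by norm_num) hy2 h0
    rw [hz] at this; norm_num at this
  have hcont : ContinuousOn (fun r => r * g r ^ 2 + l * (r * φ r ^ 2)) (Icc 1 2) := by fun_prop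
  obtain ⟨pc, pd⟩ := prim_aux (by norm_num) hcont
  have hq : ContinuousOn (fun r => φ r ^ 2 * z r / y r) (Icc 1 2) := by
    intro r hr
    rcases hr.1.eq_or_lt with e | e1
    · subst e
      rw [continuousWithinAt_Icc_iff_Ici (by norm_num), ← continuousWithinAt_Ioi_iff_Ici]
      have t1 : Tendsto (fun r => φ r / (r - 1)) (𝓝[>] 1) (𝓝 (g 1)) := by
        have h3 : HasDerivWithinAt φ (g 1) (Ioi 1) 1 := (hd 1 hr).mono_of_mem_nhdsWithin (by
          filter_upwards [Ioo_mem_nhdsGT (by norm_num : (1:ℝ) < 2)] with x hx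
          exact ⟨hx.1.le, hx.2.le⟩)
        refine ((hasDerivWithinAt_iff_tendsto_slope' (by simp)).1 h3).congr ?_
        intro r
        rw [slope_def_field, h1]; simp
      have t2 : Tendsto φ (𝓝[>] 1) (𝓝 0) := by
        have := hφ 1 hr
        rw [continuousWithinAt_Icc_iff_Ici (by norm_num), ← continuousWithinAt_Ioi_iff_Ici] at this
        rw [← h1]; exact this
      have t3 : Tendsto z (𝓝[>] 1) (𝓝 (z 1)) := by
        have := h.cz 1 hr
        rwa [continuousWithinAt_Icc_iff_Ici (by norm_num), ← continuousWithinAt_Ioi_iff_Ici] at this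
      have t4 := ((t1.mul t2).mul t3).div h.slope_one (by rw [hz]; norm_num)
      unfold ContinuousWithinAt
      simp only [h.y1, div_zero]
      simp only [mul_zero, zero_mul, zero_div] at t4
      apply t4.congr'
      filter_upwards [self_mem_nhdsWithin] with r hr
      have : (r:ℝ) - 1 ≠ 0 := by have : (1:ℝ) < r := hr; linarith
      simp only [Pi.div_apply]
      field_simp
    · rcases hr.2.eq_or_lt with e | e2
      · subst e
        rw [continuousWithinAt_Icc_iff_Iic (by norm_num), ← continuousWithinAt_Iio_iff_Iic]
        have t1 : Tendsto (fun r => φ r / (r - 2)) (𝓝[<] 2) (𝓝 (g 2)) := by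
          have h3 : HasDerivWithinAt φ (g 2) (Iio 2) 2 := (hd 2 hr).mono_of_mem_nhdsWithin (by
            filter_upwards [Ioo_mem_nhdsLT (by norm_num : (1:ℝ) < 2)] with x hx
            exact ⟨hx.1.le, hx.2.le⟩)
          refine ((hasDerivWithinAt_iff_tendsto_slope' (by simp)).1 h3).congr ?_
          intro r
          rw [slope_def_field, h2]; simp
        have t2 : Tendsto φ (𝓝[<] 2) (𝓝 0) := by
          have := hφ 2 hr
          rw [continuousWithinAt_Icc_iff_Iic (by norm_num), ← continuousWithinAt_Iio_iff_Iic] at this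
          rw [← h2]; exact this
        have t3 : Tendsto z (𝓝[<] 2) (𝓝 (z 2)) := by
          have := h.cz 2 hr
          rwa [continuousWithinAt_Icc_iff_Iic (by norm_num), ← continuousWithinAt_Iio_iff_Iic] at this
        have t4 := ((t1.mul t2).mul t3).div (h.slope_two hy2) (by simpa using hz2)
        unfold ContinuousWithinAt
        simp only [hy2, div_zero]
        simp only [mul_zero, zero_mul, zero_div] at t4
        apply t4.congr'
        filter_upwards [self_mem_nhdsWithin] with r hr
        have : (r:ℝ) - 2 ≠ 0 := by have : r < 2 := hr; linarith
        simp only [Pi.div_apply]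
        field_simp
      · exact (((hφ r hr).pow 2).mul (h.cz r hr)).div (h.cy r hr) (hy r ⟨e1, e2⟩).ne'
  have hmono := mono_aux (f := fun r => (∫ t in (1:ℝ)..r, (t * g t ^ 2 + l * (t * φ t ^ 2))) -
      φ r ^ 2 * z r / y r) (f' := fun r => r * (g r - φ r * z r / (r * y r)) ^ 2) (pc.sub hq)
    (fun r hr => by
      have hyr := (hy r hr).ne'
      have hr0 : r ≠ 0 := by linarith [hr.1]
      have hdφ := (hd r ⟨hr.1.le, hr.2.le⟩).hasDerivAt (Icc_mem_nhds hr.1 hr.2)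
      have := (pd r hr).sub ((((hdφ.pow 2).mul (h.dz r hr))).div (h.dy r hr) hyr)
      refine this.congr_deriv ?_
      simp
      field_simp
      ring)
    (fun r hr => by
      have : 0 < r := by linarith [hr.1]
      positivity)
  have := hmono ⟨le_rfl, by norm_num⟩ ⟨by norm_num, le_rfl⟩ (by norm_num)
  simpa [h1, h2] using this

theorem RS.forwardZero {l b : ℝ} {y z : ℝ → ℝ} (h : RS l b y z) {ρ : ℝ} (hρ : ρ ∈ Icc (1:ℝ) 2)
    (hz : z 1 = 0) : y ρ = 0 := by
  obtain ⟨Y, hY⟩ := isCompact_Icc.exists_bound_of_continuousOn h.cy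
  have hY0 : 0 ≤ Y := le_trans (norm_nonneg _) (hY 1 (by simp))
  set K : ℝ := 1 + 2 * (|l| + |b| * Y ^ 4) with hK
  have hsub : Icc 1 ρ ⊆ Icc (1:ℝ) 2 := Icc_subset_Icc_right hρ.2
  have hm := anti_aux (f := fun r => (y r ^ 2 + z r ^ 2) * Real.exp (-K * r))
    (f' := fun r => (2 * y r * (z r / r) + 2 * z r * (r * (l * y r - b * y r ^ 5))) * Real.exp (-K * r)
      + (y r ^ 2 + z r ^ 2) * (Real.exp (-K * r) * (-K))) (a := 1) (b := ρ)
    (by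
      have := h.cy.mono hsub
      have := h.cz.mono hsub
      fun_prop)
    (by
      intro r hr
      have hr' : r ∈ Ioo (1:ℝ) 2 := ⟨hr.1, hr.2.trans_le hρ.2⟩
      have h1 := (h.dy r hr').pow 2
      have h2 := (h.dz r hr').pow 2
      have h3 : HasDerivAt (fun r => Real.exp (-K * r)) (Real.exp (-K * r) * (-K)) r := by
        have := ((hasDerivAt_id r).const_mul (-K)).exp
        simpa using this
      have := (h1.add h2).mul h3
      refine this.congr_deriv ?_
      simp)
    (by
      intro r hr
      have hr' : r ∈ Ioo (1:ℝ) 2 := ⟨hr.1, hr.2.trans_le hρ.2⟩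
      have hr1 : 1 < r := hr'.1
      have hr2 : r < 2 := hr'.2
      have hyr : |y r| ≤ Y := hY r ⟨hr1.le, hr2.le⟩
      have hA : |2 * y r * (z r / r)| ≤ y r ^ 2 + z r ^ 2 := by
        have : |2 * y r * (z r / r)| = (2 * |y r| * |z r|) / r := by
          rw [abs_mul, abs_mul, abs_div, abs_of_pos (by linarith : (0:ℝ) < r)]
          simp; ring
        rw [this, div_le_iff₀ (by linarith)]
        have h1 : 2 * |y r| * |z r| ≤ y r ^ 2 + z r ^ 2 := by
          nlinarith [sq_nonneg (|y r| - |z r|), sq_abs (y r), sq_abs (z r)]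
        nlinarith [sq_nonneg (y r), sq_nonneg (z r)]
      have hB : |2 * z r * (r * (l * y r - b * y r ^ 5))| ≤
          2 * (|l| + |b| * Y ^ 4) * (y r ^ 2 + z r ^ 2) := by
        have h0 : |2 * z r * (r * (l * y r - b * y r ^ 5))| =
          r * (2 * |y r| * |z r|) * |l - b * y r ^ 4| := by
          have : 2 * z r * (r * (l * y r - b * y r ^ 5)) =
            r * (2 * y r * z r) * (l - b * y r ^ 4) := by ring
          rw [this, abs_mul, abs_mul, abs_mul, abs_mul, abs_of_pos (by linarith : (0:ℝ) < r)]
          simp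
        have h1 : 2 * |y r| * |z r| ≤ y r ^ 2 + z r ^ 2 := by
          nlinarith [sq_nonneg (|y r| - |z r|), sq_abs (y r), sq_abs (z r)]
        have h2 : |l - b * y r ^ 4| ≤ |l| + |b| * Y ^ 4 := by
          calc |l - b * y r ^ 4| ≤ |l| + |b * y r ^ 4| := abs_sub _ _
            _ = |l| + |b| * |y r| ^ 4 := by rw [abs_mul, abs_pow]
            _ ≤ _ := by gcongr
        rw [h0]
        calc r * (2 * |y r| * |z r|) * |l - b * y r ^ 4|
            ≤ 2 * (y r ^ 2 + z r ^ 2) * (|l| + |b| * Y ^ 4) := by gcongr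
          _ = _ := by ring
      have := Real.exp_pos (-K * r)
      have h5 : (2 * y r * (z r / r) + 2 * z r * (r * (l * y r - b * y r ^ 5)))
        - (y r ^ 2 + z r ^ 2) * K ≤ 0 := by
        have e1 := (abs_le.1 hA).2
        have e2 := (abs_le.1 hB).2
        rw [hK]; linarith
      have := mul_nonpos_of_nonpos_of_nonneg h5 this.le
      linarith)
  have := hm ⟨le_rfl, hρ.1⟩ ⟨hρ.1, le_rfl⟩ hρ.1
  simp only [hz, h.y1] at this
  have he := Real.exp_pos (-K * ρ)
  have h7 : (y ρ ^ 2 + z ρ ^ 2) * Real.exp (-K * ρ) ≤ 0 := by simpa using this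
  have h8 : y ρ ^ 2 + z ρ ^ 2 ≤ 0 := by
    by_contra hc
    push Not at hc
    have := mul_pos hc he
    linarith
  exact pow_eq_zero_iff (two_ne_zero) |>.1 (le_antisymm (by linarith [sq_nonneg (z ρ)]) (sq_nonneg _))


theorem lambda1_bound {l : ℝ} {y z : ℝ → ℝ} (h : RS l 0 y z) (hz : z 1 = 1)
    (hy : ∀ r ∈ Ioo (1:ℝ) 2, 0 < y r) (hy2 : y 2 = 0) : -lambda1 2 ≤ l := by
  have : -l ≤ lambda1 2 := by
    unfold lambda1
    apply le_csInf
    · refine ⟨_, fun r => (r - 1) * (2 - r), ?_, by norm_num, by norm_num, ⟨3/2, by norm_num, by norm_num⟩, rfl⟩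
      fun_prop
    · rintro q ⟨φ, hφ, h1, h2, ⟨r0, hr0, hne⟩, rfl⟩
      set g := derivWithin φ (Icc 1 2) with hgd
      have hud := uniqueDiffOn_Icc (by norm_num : (1:ℝ) < 2)
      have hg : ContinuousOn g (Icc 1 2) := hφ.continuousOn_derivWithin hud le_rfl
      have hd : ∀ r ∈ Icc (1:ℝ) 2, HasDerivWithinAt φ (g r) (Icc 1 2) r := fun r hr =>
        (hφ.differentiableOn (by norm_num) r hr).hasDerivWithinAt
      have hp := picone h hz hy hy2 hg hd h1 h2
      have hc := hφ.continuousOn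
      have e1 : ∫ r in (1:ℝ)..2, (deriv φ r) ^ 2 * r ^ (2 - 1) = ∫ r in (1:ℝ)..2, r * g r ^ 2 := by
        apply intervalIntegral.integral_congr_Ioo_of_le (by norm_num)
        intro r hr
        have : g r = deriv φ r := derivWithin_of_mem_nhds (Icc_mem_nhds hr.1 hr.2)
        simp only [this]
        ring
      have e2 : ∫ r in (1:ℝ)..2, (φ r) ^ 2 * r ^ (2 - 1) = ∫ r in (1:ℝ)..2, r * φ r ^ 2 := by
        congr 1; ext r; ring
      have hD : 0 < ∫ r in (1:ℝ)..2, r * φ r ^ 2 := by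
        apply intervalIntegral.integral_pos (by norm_num) (by fun_prop)
        · intro r hr
          have : 0 < r := by linarith [hr.1]
          positivity
        · refine ⟨r0, hr0, ?_⟩
          have : 0 < r0 := by linarith [hr0.1]
          positivity
      rw [e1, e2, le_div_iff₀ hD]
      rw [intervalIntegral.integral_add, intervalIntegral.integral_const_mul] at hp
      · linarith
      · apply ContinuousOn.intervalIntegrable
        rw [uIcc_of_le (by norm_num)]
        fun_prop
      · apply ContinuousOn.intervalIntegrable
        rw [uIcc_of_le (by norm_num)]
        fun_prop
  linarith

theorem IsPosRadSol.toRS {lam : ℝ} {u : ℝ → ℝ} (h : IsPosRadSol 2 6 lam u) :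
    RS lam 1 u (fun r => r * derivWithin u (Icc 1 2) r) := by
  obtain ⟨hc, hpos, h1, h2, he⟩ := h
  have hud := uniqueDiffOn_Icc (by norm_num : (1:ℝ) < 2)
  refine ⟨hc.continuousOn, continuousOn_id.mul (hc.continuousOn_derivWithin hud (by norm_num)), ?_, ?_, h1⟩
  · intro r hr
    have hr0 : r ≠ 0 := by linarith [hr.1]
    have := ((hc.differentiableOn (by norm_num) r ⟨hr.1.le, hr.2.le⟩).hasDerivWithinAt).hasDerivAt
      (Icc_mem_nhds hr.1 hr.2)
    refine this.congr_deriv ?_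
    field_simp
  · intro r hr
    have hr0 : r ≠ 0 := by linarith [hr.1]
    have ho : ContDiffOn ℝ (1 + 1) u (Ioo 1 2) := by
      have := hc.mono Ioo_subset_Icc_self
      rwa [one_add_one_eq_two]
    have hdd : DifferentiableAt ℝ (deriv u) r :=
      (((contDiffOn_succ_iff_deriv_of_isOpen isOpen_Ioo).1 ho).2.2.differentiableOn (by norm_num)
        r hr).differentiableAt (isOpen_Ioo.mem_nhds hr)
    have h3 := (hasDerivAt_id r).mul hdd.hasDerivAt
    have h4 : HasDerivAt (fun r => r * derivWithin u (Icc 1 2) r) _ r := h3.congr_of_eventuallyEq (by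
      filter_upwards [isOpen_Ioo.mem_nhds hr] with x hx
      rw [derivWithin_of_mem_nhds (Icc_mem_nhds hx.1 hx.2)]
      simp)
    refine h4.congr_deriv ?_
    have h5 := he r hr
    have h6 : u r ^ ((6:ℝ) - 1) = u r ^ 5 := by
      rw [show (6:ℝ) - 1 = (5:ℕ) by norm_num, Real.rpow_natCast]
    rw [h6] at h5
    have h7 : deriv (deriv u) r = lam * u r - u r ^ 5 - 1 / r * deriv u r := by
      norm_num at h5 ⊢
      linarith
    simp only [id, h7]
    field_simp
    ring

theorem RS.slope_pos {l b : ℝ} {y z : ℝ → ℝ} (h : RS l b y z) (hy : ∀ r ∈ Ioo (1:ℝ) 2, 0 < y r) :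
    0 < z 1 := by
  have hne : z 1 ≠ 0 := by
    intro h0
    have := h.forwardZero (ρ := 3/2) (by norm_num) h0
    have := hy (3/2) (by norm_num)
    linarith
  have : 0 ≤ z 1 := by
    apply ge_of_tendsto h.slope_one
    filter_upwards [Ioo_mem_nhdsGT (by norm_num : (1:ℝ) < 2)] with r hr
    have := hy r hr
    have : 0 < r - 1 := by linarith [hr.1]
    positivity
  exact lt_of_le_of_ne this (Ne.symm hne)

theorem within_of_Ioo {f f' : ℝ → ℝ} (hc : ContinuousOn f (Icc 1 2))
    (hd : ∀ r ∈ Ioo (1:ℝ) 2, HasDerivAt f (f' r) r) (hc' : ContinuousOn f' (Icc 1 2)) :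
    ∀ r ∈ Icc (1:ℝ) 2, HasDerivWithinAt f (f' r) (Icc 1 2) r := by
  intro r hr
  rcases hr.1.eq_or_lt with e | e1
  · subst e
    refine HasDerivWithinAt.mono ?_ Icc_subset_Ici_self
    apply hasDerivWithinAt_Ici_of_tendsto_deriv (s := Ioo 1 2)
    · intro r hr
      exact (hd r hr).differentiableAt.differentiableWithinAt
    · exact (hc 1 (by simp)).mono Ioo_subset_Icc_self
    · exact Ioo_mem_nhdsGT (by norm_num)
    · have h2 : Tendsto f' (𝓝[>] 1) (𝓝 (f' 1)) := by
        have := hc' 1 hr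
        rwa [continuousWithinAt_Icc_iff_Ici (by norm_num), ← continuousWithinAt_Ioi_iff_Ici] at this
      apply h2.congr'
      filter_upwards [Ioo_mem_nhdsGT (by norm_num : (1:ℝ) < 2)] with x hx
      exact (hd x hx).deriv.symm
  · rcases hr.2.eq_or_lt with e | e2
    · subst e
      refine HasDerivWithinAt.mono ?_ Icc_subset_Iic_self
      apply hasDerivWithinAt_Iic_of_tendsto_deriv (s := Ioo 1 2)
      · intro r hr
        exact (hd r hr).differentiableAt.differentiableWithinAt
      · exact (hc 2 (by simp)).mono Ioo_subset_Icc_self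
      · exact Ioo_mem_nhdsLT (by norm_num)
      · have h2 : Tendsto f' (𝓝[<] 2) (𝓝 (f' 2)) := by
          have := hc' 2 hr
          rwa [continuousWithinAt_Icc_iff_Iic (by norm_num), ← continuousWithinAt_Iio_iff_Iic] at this
        apply h2.congr'
        filter_upwards [Ioo_mem_nhdsLT (by norm_num : (1:ℝ) < 2)] with x hx
        exact (hd x hx).deriv.symm
    · exact (hd r ⟨e1, e2⟩).hasDerivWithinAt

theorem cd_succ {f f' : ℝ → ℝ} {n : ℕ} (h : ∀ r ∈ Icc (1:ℝ) 2, HasDerivWithinAt f (f' r) (Icc 1 2) r)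
    (h' : ContDiffOn ℝ n f' (Icc 1 2)) : ContDiffOn ℝ (n + 1) f (Icc 1 2) := by
  have hud := uniqueDiffOn_Icc (by norm_num : (1:ℝ) < 2)
  rw [contDiffOn_succ_iff_derivWithin hud]
  refine ⟨fun r hr => (h r hr).differentiableWithinAt, by simp, ?_⟩
  exact h'.congr (fun r hr => (h r hr).derivWithin (hud r hr))

theorem RS.toSol {lam : ℝ} {u ζ : ℝ → ℝ} (h : RS lam 1 u ζ) (hpos : ∀ r ∈ Ioo (1:ℝ) 2, 0 < u r)
    (h2 : u 2 = 0) : IsPosRadSol 2 6 lam u := by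
  have hr0 : ∀ r ∈ Icc (1:ℝ) 2, r ≠ 0 := fun r hr => by linarith [hr.1]
  have hcu := h.cy
  have hcz := h.cz
  have hzr : ContinuousOn (fun r => ζ r / r) (Icc 1 2) := hcz.div continuousOn_id hr0
  have hd2 : ∀ r ∈ Ioo (1:ℝ) 2, HasDerivAt (fun r => ζ r / r) ((lam * u r - u r ^ 5) - ζ r / r / r) r := by
    intro r hr
    have hr0 : r ≠ 0 := by linarith [hr.1]
    refine ((h.dz r hr).div (hasDerivAt_id r) hr0).congr_deriv ?_
    simp only [id]
    field_simp
  refine ⟨?_, hpos, h.y1, h2, ?_⟩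
  · have c0 : ContDiffOn ℝ ((0:ℕ)) (fun r => (lam * u r - u r ^ 5) - ζ r / r / r) (Icc 1 2) := by
      rw [Nat.cast_zero, contDiffOn_zero]
      exact (by fun_prop : ContinuousOn (fun r => lam * u r - u r ^ 5) (Icc 1 2)).sub
        (hzr.div continuousOn_id hr0)
    have c1 := cd_succ (within_of_Ioo hzr hd2 c0.continuousOn) c0
    have c1' : ContDiffOn ℝ ((1:ℕ)) (fun r => ζ r / r) (Icc 1 2) := by simpa using c1
    have c2 := cd_succ (within_of_Ioo hcu h.dy hzr) c1'
    have e : (((1:ℕ) : WithTop ℕ∞) + 1) = 2 := by norm_num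
    rwa [e] at c2
  · intro r hr
    have hr0 : r ≠ 0 := by linarith [hr.1]
    have h6 : u r ^ ((6:ℝ) - 1) = u r ^ 5 := by
      rw [show (6:ℝ) - 1 = (5:ℕ) by norm_num, Real.rpow_natCast]
    have hdu : deriv u =ᶠ[𝓝 r] fun r => ζ r / r := by
      filter_upwards [isOpen_Ioo.mem_nhds hr] with x hx
      exact (h.dy x hx).deriv
    rw [hdu.deriv_eq, (hd2 r hr).deriv, (h.dy r hr).deriv, h6]
    push_cast
    field_simp
    ring

theorem mass_two (u : ℝ → ℝ) : mass 2 u = ∫ r in (1:ℝ)..2, u r ^ 2 * r := by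
  unfold mass
  congr 1; ext r; ring

theorem sol_struct {lam : ℝ} {u : ℝ → ℝ} (h : IsPosRadSol 2 6 lam u) :
    ∃ (b : ℝ) (y z : ℝ → ℝ), 0 < b ∧ RS lam b y z ∧ z 1 = 1 ∧ (∀ r ∈ Ioo (1:ℝ) 2, 0 < y r) ∧ y 2 = 0 ∧
      mass 2 u = Real.sqrt b * ∫ r in (1:ℝ)..2, y r ^ 2 * r := by
  have hR := h.toRS
  set ζ := fun r => r * derivWithin u (Icc 1 2) r with hζ
  have hα := hR.slope_pos h.2.1
  set α := ζ 1 with hαd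
  have h1 : RS lam (α⁻¹ ^ 4 * α ^ 4) u ζ := by
    rw [inv_pow, inv_mul_cancel₀ (by positivity)]; exact hR
  refine ⟨α ^ 4, _, _, by positivity, h1.scale, ?_, ?_, ?_, ?_⟩
  · exact inv_mul_cancel₀ hα.ne'
  · intro r hr
    have := h.2.1 r hr
    positivity
  · simp [h.2.2.2.1]
  · rw [mass_two, ← intervalIntegral.integral_const_mul]
    have : Real.sqrt (α ^ 4) = α ^ 2 := by
      rw [show α ^ 4 = (α ^ 2) ^ 2 by ring, Real.sqrt_sq (by positivity)]
    rw [this]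
    congr 1; ext r
    field_simp

theorem mass_pos {lam : ℝ} {u : ℝ → ℝ} (h : IsPosRadSol 2 6 lam u) : 0 < mass 2 u := by
  rw [mass_two]
  have hc := h.1.continuousOn
  apply intervalIntegral.integral_pos (by norm_num) (by fun_prop)
  · intro r hr
    have : 0 < r := by linarith [hr.1]
    positivity
  · refine ⟨3/2, by norm_num, ?_⟩
    have := h.2.1 (3/2) (by norm_num)
    positivity

theorem mass_le {lam : ℝ} {u : ℝ → ℝ} (h : IsPosRadSol 2 6 lam u) : mass 2 u ≤ 18 := by
  rw [mass_two]
  exact h.toRS.mass_bound h.2.1 h.2.2.2.1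

theorem sol_of_Sg {L B l b : ℝ} (hL : 0 ≤ L) (hB : 0 ≤ B) (hp : (l, b) ∈ Sg L B) (hb : 0 < b) :
    ∃ u, IsPosRadSol 2 6 l u ∧ mass 2 u = mp L B (l, b) := by
  have h := fam_RS hL hB hp.1 hp.2.1
  have hz := (fam_CS hL hB (l, b)).z1
  have hpos := h.pos_of_nonneg (by rw [hz]; norm_num) hp.2.1
  set a := Real.sqrt (Real.sqrt b) with ha
  have ha0 : 0 < a := Real.sqrt_pos.2 (Real.sqrt_pos.2 hb)
  have ha2 : a ^ 2 = Real.sqrt b := Real.sq_sqrt (Real.sqrt_nonneg _)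
  have ha4 : a ^ 4 = b := by
    have : a ^ 4 = (a ^ 2) ^ 2 := by ring
    rw [this, ha2, Real.sq_sqrt hb.le]
  have h' : RS l (a ^ 4 * 1) (FY L B (l, b)) (FZ L B (l, b)) := by rw [ha4, mul_one]; exact h
  refine ⟨_, h'.scale.toSol (fun r hr => mul_pos ha0 (hpos r hr)) (by simp [hp.2.2]), ?_⟩
  rw [mass_two]
  unfold mp
  rw [← intervalIntegral.integral_const_mul]
  simp only
  rw [← ha2]
  congr 1; ext r; ring

theorem mem_Sg {L B l b : ℝ} {y z : ℝ → ℝ} (hL : 0 ≤ L) (hl : |l| ≤ L) (hb : 0 ≤ b)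
    (hbB : b ≤ B) (h : RS l b y z) (hz : z 1 = 1) (hy : ∀ r ∈ Ioo (1:ℝ) 2, 0 < y r) (hy2 : y 2 = 0) :
    (l, b) ∈ Sg L B ∧ mp L B (l, b) = Real.sqrt b * ∫ r in (1:ℝ)..2, y r ^ 2 * r := by
  have hB : 0 ≤ B := hb.trans hbB
  have hbx : (l, b) ∈ bx L B := ⟨abs_le.1 hl, hb, hbB⟩
  have h0 : ∀ r ∈ Icc (1:ℝ) 2, 0 ≤ y r := by
    intro r hr
    rcases hr.1.eq_or_lt with e | e1
    · rw [← e, h.y1]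
    · rcases hr.2.eq_or_lt with e | e2
      · rw [e, hy2]
      · exact (hy r ⟨e1, e2⟩).le
  have he := fam_eq hL hB hbx h hz h0
  refine ⟨⟨hbx, ?_, ?_⟩, ?_⟩
  · intro r hr; rw [he r hr]; exact h0 r hr
  · rw [he 2 (by norm_num)]; exact hy2
  · unfold mp
    congr 1
    apply intervalIntegral.integral_congr_Ioo_of_le (by norm_num)
    intro r hr
    simp only [he r ⟨hr.1.le, hr.2.le⟩]

theorem stmt1 :
    ∃ η₁ : ℝ, 0 < η₁ ∧
      (∀ c : ℝ, 0 < c → c < η₁ → ∃ lam : ℝ, -lambda1 2 < lam ∧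
        ∃ u : ℝ → ℝ, IsPosRadSol 2 6 lam u ∧ mass 2 u = c) ∧
      (∀ c : ℝ, η₁ < c → ¬ ∃ lam : ℝ, -lambda1 2 < lam ∧
        ∃ u : ℝ → ℝ, IsPosRadSol 2 6 lam u ∧ mass 2 u = c) := by
  obtain ⟨a, Y, Z, ha, H, hZ, hY, hY2⟩ := exists_lstar
  have hla := lambda1_bound H hZ hY hY2
  set S := {c : ℝ | ∃ lam : ℝ, -lambda1 2 < lam ∧
        ∃ u : ℝ → ℝ, IsPosRadSol 2 6 lam u ∧ mass 2 u = c} with hS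
  have hbd : BddAbove S := by
    refine ⟨18, ?_⟩
    rintro c ⟨lam, _, u, hu, rfl⟩
    exact mass_le hu
  have hapr : ∀ L : ℝ, ∃ B : ℝ, 0 ≤ B ∧ ∀ (l b : ℝ) (y z : ℝ → ℝ), |l| ≤ L → 0 ≤ b → RS l b y z →
      (∀ r ∈ Icc (1:ℝ) 2, 0 ≤ y r) → z 1 = 1 → b < B := by
    intro L
    obtain ⟨B, hB, h⟩ := RS.apriori L
    refine ⟨B + 1, by linarith, ?_⟩
    intro l b y z h1 h2 h3 h4 h5
    linarith [h l b y z h1 h2 h3 h4 h5]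
  have hSg_pos : ∀ {L B l b : ℝ}, 0 ≤ L → 0 ≤ B → a < l → (l, b) ∈ Sg L B → 0 < b := by
    intro L B l b hL hB hal hp
    refine lt_of_le_of_ne hp.1.2.1 ?_
    intro h0

    subst h0
    have h := fam_RS hL hB hp.1 hp.2.1
    have := h.pos_gt H (fam_CS hL hB _).z1 hY hY2.ge hal 2 (by norm_num)
    rw [hp.2.2] at this
    exact lt_irrefl _ this
  have hne : ∃ c ∈ S, 0 < c := by
    obtain ⟨B, hB, hap⟩ := hapr 1
    obtain ⟨b, hb⟩ := exists_beta ha H hY hY2 zero_le_one hB hap ha (by norm_num)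
    have hb0 := hSg_pos zero_le_one hB ha hb
    obtain ⟨u, hu, hm⟩ := sol_of_Sg zero_le_one hB hb hb0
    exact ⟨mass 2 u, ⟨0, by linarith, u, hu, rfl⟩, mass_pos hu⟩
  obtain ⟨c1, hc1, hc1p⟩ := hne
  refine ⟨sSup S, lt_of_lt_of_le hc1p (le_csSup hbd hc1), ?_, ?_⟩
  · intro c hc hcη
    obtain ⟨c0, ⟨lam, hlam, u, hu, hmu⟩, hcc⟩ := exists_lt_of_lt_csSup ⟨c1, hc1⟩ hcη
    obtain ⟨b0, y, z, hb0, hR, hz, hy, hy2, hmass⟩ := sol_struct hu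
    have hal := hR.lt_of_pos H hb0 hy hy2 hY hY2
    set L := max |lam| |a| with hLd
    have hL : 0 ≤ L := (abs_nonneg a).trans (le_max_right _ _)
    obtain ⟨B, hB, hap⟩ := hapr L
    have hy0 : ∀ r ∈ Icc (1:ℝ) 2, 0 ≤ y r := by
      intro r hr
      rcases hr.1.eq_or_lt with e | e1
      · rw [← e, hR.y1]
      · rcases hr.2.eq_or_lt with e | e2
        · rw [e, hy2]
        · exact (hy r ⟨e1, e2⟩).le
    have hb0B := hap lam b0 y z (le_max_left _ _) hb0.le hR hy0 hz
    obtain ⟨hmem, hmp⟩ := mem_Sg hL (le_max_left _ _) hb0.le hb0B.le hR hz hy hy2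
    obtain ⟨hmem0, hmp0⟩ := mem_Sg hL (le_max_right |lam| |a|) le_rfl hB H hZ hY hY2
    obtain ⟨l, hl, b, hlb, hmc⟩ := mp_ivt (c := c) hL hB hmem0 (by rw [hmp0]; simp; exact hc.le) hmem hal.le
      (by rw [hmp, ← hmass, hmu]; exact hcc.le)
      (by
        intro l hl
        rcases hl.1.eq_or_lt with e | e
        · exact ⟨0, by rw [← e]; exact hmem0⟩
        · apply exists_beta ha H hY hY2 hL hB hap e
          rw [abs_le]
          have h1 := (abs_le.1 (le_max_right |lam| |a|)).1
          have h2 := (abs_le.1 (le_max_left |lam| |a|)).2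
          exact ⟨h1.trans hl.1, hl.2.trans h2⟩)
    have hb : 0 < b := by
      refine lt_of_le_of_ne hlb.1.2.1 ?_
      intro h0

      subst h0
      have : mp L B (l, 0) = 0 := by simp [mp]
      linarith
    obtain ⟨v, hv, hmv⟩ := sol_of_Sg hL hB hlb hb
    have h := fam_RS hL hB hlb.1 hlb.2.1
    have hz1 := (fam_CS hL hB (l, b)).z1
    have hgt : a < l := h.lt_of_pos H hb (h.pos_of_nonneg (by rw [hz1]; norm_num) hlb.2.1) hlb.2.2 hY hY2
    exact ⟨l, by linarith, v, hv, by rw [hmv, hmc]⟩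
  · intro c hc hex
    have : c ∈ S := hex
    linarith [le_csSup hbd this]
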